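/- arXiv:0909.4696 — 3 statements merged into one kernel-verified Lean document; each statement's English description precedes it below -/
import Mathlib

section
/- (Boundary estimate by moving planes, convex case.) Let n ≥ 2 and let Ω ⊆ ℝⁿ be a bounded smooth domain which is convex. Then there exist positive constants ρ and γ, depending only on Ω, such that for every locally Lipschitz function f : ℝ → ℝ and every positive classical solution u of −Δu = f(u) in Ω with u = 0 on ∂Ω, the following holds: (a) for every x ∈ Ω with dist(x,∂Ω) < ρ there exists a measurable set I_x ⊆ Ω with Lebesgue measure |I_x| ≥ γ such that u(x) ≤ u(y) for all y ∈ I_x; (b) consequently, sup_{x ∈ Ω_ρ} u(x) ≤ (1/γ) ∫_Ω u(y) dy, where Ω_ρ = {x ∈ Ω : dist(x,∂Ω) < ρ}. -/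
open MeasureTheory Filter

noncomputable section

/-- The Euclidean Laplacian: trace of the Hessian. -/
def lapl {n : ℕ} (u : EuclideanSpace ℝ (Fin n) → ℝ) (x : EuclideanSpace ℝ (Fin n)) : ℝ :=
  ∑ i : Fin n, fderiv ℝ (fun y => fderiv ℝ u y (EuclideanSpace.single i 1)) x
    (EuclideanSpace.single i 1)

/-- Entries of the Hessian matrix. -/
def hess {n : ℕ} (u : EuclideanSpace ℝ (Fin n) → ℝ) (x : EuclideanSpace ℝ (Fin n))
    (i j : Fin n) : ℝ :=
  fderiv ℝ (fun y => fderiv ℝ u y (EuclideanSpace.single j 1)) x (EuclideanSpace.single i 1)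

/-- A bounded smooth domain of ℝⁿ. -/
def IsSmoothBoundedDomain {n : ℕ} (Ω : Set (EuclideanSpace ℝ (Fin n))) : Prop :=
  IsOpen Ω ∧ Bornology.IsBounded Ω ∧ Ω.Nonempty ∧
  ∃ ρ : EuclideanSpace ℝ (Fin n) → ℝ, ContDiff ℝ (⊤ : ℕ∞) ρ ∧
    Ω = {x | ρ x < 0} ∧ frontier Ω = {x | ρ x = 0} ∧
    ∀ x ∈ frontier Ω, gradient ρ x ≠ 0

/-- Classical solution of −Δu = f(u) in Ω, u = 0 on ∂Ω. -/
def IsClassicalSol {n : ℕ} (Ω : Set (EuclideanSpace ℝ (Fin n))) (f : ℝ → ℝ)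
    (u : EuclideanSpace ℝ (Fin n) → ℝ) : Prop :=
  (∃ U, IsOpen U ∧ closure Ω ⊆ U ∧ ContDiffOn ℝ 2 u U) ∧
  (∀ x ∈ Ω, lapl u x + f (u x) = 0) ∧
  (∀ x ∈ frontier Ω, u x = 0)

/-- Semi-stability of a solution u. -/
def IsSemiStable {n : ℕ} (Ω : Set (EuclideanSpace ℝ (Fin n))) (f : ℝ → ℝ)
    (u : EuclideanSpace ℝ (Fin n) → ℝ) : Prop :=
  ∀ ξ : EuclideanSpace ℝ (Fin n) → ℝ, (∃ K : NNReal, LipschitzWith K ξ) →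
    (∀ x ∈ frontier Ω, ξ x = 0) →
    0 ≤ ∫ x in Ω, (‖gradient ξ x‖ ^ 2 - deriv f (u x) * ξ x ^ 2)

/-- Weak solution of −Δu = f(u) in Ω, u = 0 on ∂Ω. -/
def IsWeakSol {n : ℕ} (Ω : Set (EuclideanSpace ℝ (Fin n))) (f : ℝ → ℝ)
    (u : EuclideanSpace ℝ (Fin n) → ℝ) : Prop :=
  IntegrableOn u Ω volume ∧
  IntegrableOn (fun x => f (u x) * Metric.infDist x (frontier Ω)) Ω volume ∧
  ∀ ξ : EuclideanSpace ℝ (Fin n) → ℝ,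
    (∃ U, IsOpen U ∧ closure Ω ⊆ U ∧ ContDiffOn ℝ 2 ξ U) →
    (∀ x ∈ frontier Ω, ξ x = 0) →
    ∫ x in Ω, (u x * lapl ξ x + f (u x) * ξ x) = 0

section Auxiliary

open Topology Laplacian InnerProductSpace

section Calculus

variable {E : Type*} [NormedAddCommGroup E] [NormedSpace ℝ E]

lemma hasDerivAt_line (x v : E) (s : ℝ) : HasDerivAt (fun s : ℝ => x + s • v) v s := by
  simpa using ((hasDerivAt_id s).smul_const v).const_add x

lemma deriv_deriv_line {G : E → ℝ} {x : E} (hG : ContDiffAt ℝ 2 G x) (v : E) :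
    deriv (deriv fun s : ℝ => G (x + s • v)) 0 = iteratedFDeriv ℝ 2 G x ![v, v] := by
  have hd : ∀ᶠ y in 𝓝 x, DifferentiableAt ℝ G y := by
    filter_upwards [hG.eventually (by simp)] with y hy
    exact hy.differentiableAt (by simp)
  have hc : Tendsto (fun s : ℝ => x + s • v) (𝓝 0) (𝓝 x) := by
    have : ContinuousAt (fun s : ℝ => x + s • v) 0 := (hasDerivAt_line x v 0).continuousAt
    simpa [ContinuousAt] using this
  have h1 : deriv (fun s : ℝ => G (x + s • v)) =ᶠ[𝓝 0] fun s => fderiv ℝ G (x + s • v) v := by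
    filter_upwards [hc.eventually hd] with s hs
    exact (hs.hasFDerivAt.comp_hasDerivAt s (hasDerivAt_line x v s)).deriv
  have h2 : DifferentiableAt ℝ (fderiv ℝ G) (x + (0 : ℝ) • v) := by
    simpa using (hG.fderiv_right (m := 1) (by norm_num)).differentiableAt (by simp)
  rw [h1.deriv_eq, iteratedFDeriv_two_apply]
  have h3 := h2.hasFDerivAt.comp_hasDerivAt 0 (hasDerivAt_line x v 0)
  have h4 := h3.clm_apply (hasDerivAt_const (0 : ℝ) v)
  simpa using h4.deriv

lemma deriv_deriv_nonneg_of_isLocalMin {f : ℝ → ℝ} {a : ℝ} (h : IsLocalMin f a)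
    (hc : ContinuousAt f a) : 0 ≤ deriv (deriv f) a := by
  by_contra! hlt
  have hmax : IsLocalMin (-f) a := by
    refine isLocalMin_of_deriv_deriv_pos ?_ ?_ hc.neg
    · have : deriv (-f) = -deriv f := by ext; simp
      rw [this, deriv.neg]; linarith
    · rw [deriv.neg, h.deriv_eq_zero, neg_zero]
  have hconst : f =ᶠ[𝓝 a] fun _ => f a := by
    filter_upwards [h, hmax] with y h1 h2
    simp at h2
    exact le_antisymm h2 h1
  rw [hconst.deriv.deriv_eq] at hlt
  simp at hlt

end Calculus

section Laplace

variable {E : Type*} [NormedAddCommGroup E] [InnerProductSpace ℝ E] [FiniteDimensional ℝ E]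

lemma laplacian_eq_sum_deriv_deriv {ι : Type*} [Fintype ι] (b : OrthonormalBasis ι ℝ E)
    {G : E → ℝ} {x : E} (hG : ContDiffAt ℝ 2 G x) :
    Δ G x = ∑ i, deriv (deriv fun s : ℝ => G (x + s • b i)) 0 := by
  rw [laplacian_eq_iteratedFDeriv_orthonormalBasis G b]
  simp only [deriv_deriv_line hG]

lemma laplacian_nonneg_of_isLocalMin {G : E → ℝ} {x : E} (hG : ContDiffAt ℝ 2 G x)
    (h : IsLocalMin G x) : 0 ≤ Δ G x := by
  rw [laplacian_eq_sum_deriv_deriv (stdOrthonormalBasis ℝ E) hG]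
  refine Finset.sum_nonneg fun i _ => deriv_deriv_nonneg_of_isLocalMin ?_ ?_
  · have hc : ContinuousAt (fun s : ℝ => x + s • stdOrthonormalBasis ℝ E i) 0 :=
      (hasDerivAt_line _ _ 0).continuousAt
    have h' : IsLocalMin G ((fun s : ℝ => x + s • stdOrthonormalBasis ℝ E i) 0) := by simpa using h
    exact IsMinFilter.comp_tendsto (f := G) h' hc
  · refine ContinuousAt.comp (g := G) ?_ (hasDerivAt_line _ _ 0).continuousAt
    simpa using hG.continuousAt

lemma laplacian_comp_isometry (L : E ≃ₗᵢ[ℝ] E) (c : E) {G : E → ℝ} {x : E}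
    (hG : ContDiffAt ℝ 2 G (L x + c)) : Δ (fun y => G (L y + c)) x = Δ G (L x + c) := by
  have hG' : ContDiffAt ℝ 2 (fun y => G (L y + c)) x :=
    ContDiffAt.comp x hG (L.contDiff.add contDiff_const).contDiffAt
  rw [laplacian_eq_sum_deriv_deriv (stdOrthonormalBasis ℝ E) hG',
    laplacian_eq_sum_deriv_deriv ((stdOrthonormalBasis ℝ E).map L) hG]
  refine Finset.sum_congr rfl fun i _ => ?_
  congr 3
  ext s
  simp only [map_add, map_smul, OrthonormalBasis.map_apply]
  congr 1
  abel

/-- A function of a linear form. -/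
lemma laplacian_comp_inner (a : E) (ha : ‖a‖ = 1) {F F' : ℝ → ℝ} {F'' c : ℝ} {x : E}
    (hF : ContDiff ℝ 2 F) (h1 : ∀ r, HasDerivAt F (F' r) r)
    (h2 : HasDerivAt F' F'' (c - inner ℝ a x)) :
    Δ (fun y => F (c - inner ℝ a y)) x = F'' := by
  have hG : ContDiffAt ℝ 2 (fun y => F (c - inner ℝ a y)) x := by
    apply ContDiff.contDiffAt
    exact hF.comp (contDiff_const.sub (contDiff_const.inner ℝ contDiff_id))
  rw [laplacian_eq_sum_deriv_deriv (stdOrthonormalBasis ℝ E) hG]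
  set b := stdOrthonormalBasis ℝ E
  have key : ∀ i, deriv (deriv fun s : ℝ => F (c - inner ℝ a (x + s • b i))) 0
      = F'' * (inner ℝ a (b i)) ^ 2 := by
    intro i
    have hl : ∀ s : ℝ, HasDerivAt (fun s : ℝ => c - inner ℝ a (x + s • b i))
        (-inner ℝ a (b i)) s := by
      intro s
      simp only [inner_add_right, inner_smul_right]
      simpa using (((hasDerivAt_id s).mul_const (inner ℝ a (b i))).const_add
        (inner ℝ a x)).const_sub c
    have e1 : (deriv fun s : ℝ => F (c - inner ℝ a (x + s • b i)))
        = fun s => F' (c - inner ℝ a (x + s • b i)) * (-inner ℝ a (b i)) := by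
      ext s
      exact ((h1 _).comp s (hl s)).deriv
    rw [e1]
    have h2' : HasDerivAt F' F'' (c - inner ℝ a (x + (0 : ℝ) • b i)) := by simpa using h2
    refine ((h2'.comp (0 : ℝ) (hl 0)).mul_const _).deriv.trans ?_
    ring
  rw [Finset.sum_congr rfl fun i _ => key i, ← Finset.mul_sum]
  have := b.sum_sq_inner_right a
  simp only [real_inner_comm] at this ⊢
  simp_all

/-- A radial function. -/
lemma laplacian_comp_norm_sq (p : E) {F F' : ℝ → ℝ} {F'' : ℝ} {x : E}
    (hF : ContDiff ℝ 2 F) (h1 : ∀ r, HasDerivAt F (F' r) r)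
    (h2 : HasDerivAt F' F'' (‖x - p‖ ^ 2)) :
    Δ (fun y => F (‖y - p‖ ^ 2)) x
      = 4 * F'' * ‖x - p‖ ^ 2 + 2 * Module.finrank ℝ E * F' (‖x - p‖ ^ 2) := by
  have hG : ContDiffAt ℝ 2 (fun y => F (‖y - p‖ ^ 2)) x := by
    apply ContDiff.contDiffAt
    exact hF.comp ((contDiff_id.sub contDiff_const).norm_sq ℝ)
  rw [laplacian_eq_sum_deriv_deriv (stdOrthonormalBasis ℝ E) hG]
  set b := stdOrthonormalBasis ℝ E
  have key : ∀ i, deriv (deriv fun s : ℝ => F (‖x + s • b i - p‖ ^ 2)) 0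
      = 4 * F'' * (inner ℝ (b i) (x - p)) ^ 2 + 2 * F' (‖x - p‖ ^ 2) := by
    intro i
    have e0 : ∀ s : ℝ, ‖x + s • b i - p‖ ^ 2
        = ‖x - p‖ ^ 2 + 2 * inner ℝ (b i) (x - p) * s + s ^ 2 := by
      intro s
      have : x + s • b i - p = (x - p) + s • b i := by abel
      rw [this, norm_add_sq_real, inner_smul_right, norm_smul, b.norm_eq_one,
        real_inner_comm]
      simp; ring
    simp only [e0]
    have hl : ∀ s : ℝ, HasDerivAt (fun s : ℝ => ‖x - p‖ ^ 2 + 2 * inner ℝ (b i) (x - p) * s + s ^ 2)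
        (2 * inner ℝ (b i) (x - p) + 2 * s) s := by
      intro s
      refine HasDerivAt.add (g := fun s => s ^ 2) ?_ (by simpa using hasDerivAt_pow 2 s)
      simpa using ((hasDerivAt_id s).const_mul (2 * inner ℝ (b i) (x - p))).const_add
        (‖x - p‖ ^ 2)
    have e1 : (deriv fun s : ℝ => F (‖x - p‖ ^ 2 + 2 * inner ℝ (b i) (x - p) * s + s ^ 2))
        = fun s => F' (‖x - p‖ ^ 2 + 2 * inner ℝ (b i) (x - p) * s + s ^ 2)
          * (2 * inner ℝ (b i) (x - p) + 2 * s) := by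
      ext s
      exact ((h1 _).comp s (hl s)).deriv
    rw [e1]
    have h2' : HasDerivAt F' F'' (‖x - p‖ ^ 2 + 2 * inner ℝ (b i) (x - p) * 0 + 0 ^ 2) := by
      simpa using h2
    have hm : HasDerivAt (fun s : ℝ => 2 * inner ℝ (b i) (x - p) + 2 * s) 2 0 := by
      simpa using ((hasDerivAt_id (0 : ℝ)).const_mul 2).const_add (2 * inner ℝ (b i) (x - p))
    refine ((h2'.comp (0 : ℝ) (hl 0)).mul hm).deriv.trans ?_
    simp
    ring
  rw [Finset.sum_congr rfl fun i _ => key i, Finset.sum_add_distrib, ← Finset.mul_sum]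
  rw [b.sum_sq_inner_right (x - p)]
  simp
  ring

lemma lapl_eq_laplacian {n : ℕ} {u : EuclideanSpace ℝ (Fin n) → ℝ} {x : EuclideanSpace ℝ (Fin n)}
    (hu : ContDiffAt ℝ 2 u x) : lapl u x = Δ u x := by
  rw [laplacian_eq_iteratedFDeriv_orthonormalBasis u (EuclideanSpace.basisFun (Fin n) ℝ), lapl]
  refine Finset.sum_congr rfl fun i _ => ?_
  have h2 : DifferentiableAt ℝ (fderiv ℝ u) x :=
    (hu.fderiv_right (m := 1) (by norm_num)).differentiableAt (by simp)
  rw [iteratedFDeriv_two_apply, fderiv_clm_apply h2 (differentiableAt_const _)]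
  simp

end Laplace

section MaximumPrinciples

variable {E : Type*} [NormedAddCommGroup E] [InnerProductSpace ℝ E] [FiniteDimensional ℝ E]

lemma pos_on_ball_of_pos_on_closedBall {w : E → ℝ} {C : ℝ} (hC : 0 ≤ C) {p : E} {r R : ℝ}
    (hr : 0 < r) (hcont : ContinuousOn w (Metric.closedBall p R))
    (hd : ∀ x ∈ Metric.ball p R, ContDiffAt ℝ 2 w x)
    (hl : ∀ x ∈ Metric.ball p R, Δ w x ≤ C * w x)
    (h0 : ∀ x ∈ Metric.closedBall p R, 0 ≤ w x)
    (hpos : ∀ x ∈ Metric.closedBall p r, 0 < w x) :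
    ∀ x ∈ Metric.ball p R, 0 < w x := by
  intro z hz
  rcases le_or_gt (dist z p) r with hzr | hzr
  · exact hpos z hzr
  have hrR : r < R := hzr.trans hz
  have hsub : Metric.closedBall p r ⊆ Metric.closedBall p R :=
    Metric.closedBall_subset_closedBall hrR.le
  obtain ⟨q, hq, hqmin⟩ := (isCompact_closedBall p r).exists_isMinOn
    ⟨p, Metric.mem_closedBall_self hr.le⟩ (hcont.mono hsub)
  set m := w q with hm
  have hm0 : 0 < m := hpos q hq
  set N : ℝ := (Module.finrank ℝ E : ℝ) with hN
  have hN0 : 0 ≤ N := by positivity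
  obtain ⟨α, hα1, hα2⟩ : ∃ α : ℝ, 1 ≤ α ∧ N + C + 1 ≤ α * r ^ 2 := by
    refine ⟨(N + C + 1) / r ^ 2 + 1, ?_, ?_⟩
    · have : 0 ≤ (N + C + 1) / r ^ 2 := by positivity
      linarith
    · rw [add_mul, div_mul_cancel₀ _ (by positivity)]
      nlinarith [sq_nonneg r]
  let F : ℝ → ℝ := fun t => -m * (Real.exp (-α * t) - Real.exp (-α * R ^ 2))
  let F' : ℝ → ℝ := fun t => m * α * Real.exp (-α * t)
  have hexp : ∀ t : ℝ, HasDerivAt (fun t => Real.exp (-α * t)) (-α * Real.exp (-α * t)) t := by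
    intro t
    have := ((hasDerivAt_id t).const_mul (-α)).exp
    simpa [mul_comm] using this
  have hF1 : ∀ t, HasDerivAt F (F' t) t := by
    intro t
    refine (((hexp t).sub_const (Real.exp (-α * R ^ 2))).const_mul (-m)).congr_deriv ?_
    simp only [F']; ring
  have hF2 : ∀ t, HasDerivAt F' (-(m * α ^ 2 * Real.exp (-α * t))) t := by
    intro t
    refine ((hexp t).const_mul (m * α)).congr_deriv ?_
    ring
  have hFc : ContDiff ℝ 2 F := by fun_prop
  let G : E → ℝ := fun y => F (‖y - p‖ ^ 2)
  have hGc : ContDiff ℝ 2 G := hFc.comp ((contDiff_id.sub contDiff_const).norm_sq ℝ)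
  set A := Metric.closedBall p R \ Metric.ball p r with hA
  have hAc : IsCompact A := (isCompact_closedBall p R).diff Metric.isOpen_ball
  have hzA : z ∈ A := ⟨Metric.ball_subset_closedBall hz, by simpa using hzr.le⟩
  obtain ⟨x, hxA, hxmin⟩ := hAc.exists_isMinOn ⟨z, hzA⟩
    (((hcont.mono Set.sdiff_subset).add hGc.continuous.continuousOn : ContinuousOn (w + G) A))
  have hkey : 0 ≤ (w + G) x := by
    by_contra! hneg
    have hxR : dist x p ≤ R := hxA.1
    have hxr : r ≤ dist x p := by simpa using hxA.2
    have hGge : -m ≤ G x := by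
      have h1 : Real.exp (-α * ‖x - p‖ ^ 2) ≤ 1 := by
        apply Real.exp_le_one_iff.2
        nlinarith [sq_nonneg ‖x - p‖]
      have h2 := (Real.exp_pos (-α * R ^ 2)).le
      simp only [G, F]
      nlinarith
    rcases hxR.eq_or_lt with hxR | hxR
    · have : G x = 0 := by
        simp only [G, F, ← dist_eq_norm, hxR]; ring
      have := h0 x hxA.1
      simp only [Pi.add_apply] at hneg
      linarith
    rcases hxr.eq_or_lt with hxr | hxr
    · have : m ≤ w x := hqmin (show x ∈ Metric.closedBall p r from hxr.symm.le)
      simp only [Pi.add_apply] at hneg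
      linarith
    have hmin : IsLocalMin (w + G) x := by
      refine hxmin.isLocalMin ?_
      have : Metric.ball p R \ Metric.closedBall p r ∈ 𝓝 x :=
        (Metric.isOpen_ball.sdiff Metric.isClosed_closedBall).mem_nhds
          ⟨hxR, by simpa using hxr⟩
      exact Filter.mem_of_superset this
        (Set.sdiff_subset_sdiff Metric.ball_subset_closedBall Metric.ball_subset_closedBall)
    have h1 : 0 ≤ Δ (w + G) x :=
      laplacian_nonneg_of_isLocalMin ((hd x hxR).add hGc.contDiffAt) hmin
    rw [(hd x hxR).laplacian_add hGc.contDiffAt] at h1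
    have h2 : Δ G x = _ := laplacian_comp_norm_sq p hFc hF1 (hF2 (‖x - p‖ ^ 2))
    rw [h2, ← hN] at h1
    have h3 := hl x hxR
    rw [dist_eq_norm] at hxr
    have hs : r ^ 2 ≤ ‖x - p‖ ^ 2 := by gcongr
    set s := ‖x - p‖ ^ 2
    have he := Real.exp_pos (-α * s)
    have heR := Real.exp_pos (-α * R ^ 2)
    simp only [F', Pi.add_apply, G, F] at h1 hneg
    have h4 : C * w x ≤ C * (m * (Real.exp (-α * s) - Real.exp (-α * R ^ 2))) :=
      mul_le_mul_of_nonneg_left (by linarith) hC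
    have h5 : C * (m * (Real.exp (-α * s) - Real.exp (-α * R ^ 2))) ≤ C * m * Real.exp (-α * s) := by
      nlinarith [mul_nonneg (mul_nonneg hC hm0.le) heR.le]
    have h6 : N + C + 1 ≤ α * s := hα2.trans (by gcongr)
    have h7 : C < 4 * α ^ 2 * s - 2 * N * α := by nlinarith
    have h8 : C * (m * Real.exp (-α * s)) < (4 * α ^ 2 * s - 2 * N * α) * (m * Real.exp (-α * s)) :=
      mul_lt_mul_of_pos_right h7 (by positivity)
    nlinarith
  have h9 : (w + G) x ≤ (w + G) z := hxmin hzA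
  have h10 : G z < 0 := by
    simp only [G, F]
    have : ‖z - p‖ < R := by rw [← dist_eq_norm]; exact hz
    have : Real.exp (-α * R ^ 2) < Real.exp (-α * ‖z - p‖ ^ 2) := by
      apply Real.exp_lt_exp.2
      have : ‖z - p‖ ^ 2 < R ^ 2 := by gcongr
      nlinarith
    nlinarith
  simp only [Pi.add_apply] at hkey h9
  linarith

/-- Strong maximum principle for nonnegative supersolutions of `Δ w = C w`. -/
lemma pos_of_preconnected {S : Set E} (hS : IsOpen S) (hSc : IsPreconnected S) {w : E → ℝ}
    {C : ℝ} (hC : 0 ≤ C) (hd : ∀ x ∈ S, ContDiffAt ℝ 2 w x) (hl : ∀ x ∈ S, Δ w x ≤ C * w x)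
    (h0 : ∀ x ∈ S, 0 ≤ w x) {y : E} (hy : y ∈ S) (hwy : 0 < w y) : ∀ x ∈ S, 0 < w x := by
  have hcont : ContinuousOn w S := fun x hx => (hd x hx).continuousAt.continuousWithinAt
  have hopen : IsOpen (S ∩ w ⁻¹' Set.Ioi 0) := hcont.isOpen_inter_preimage hS isOpen_Ioi
  have := hSc.subset_of_closure_inter_subset hopen ⟨y, hy, hy, hwy⟩ ?_
  · exact fun x hx => (this hx).2
  rintro z ⟨hz, hzS⟩
  refine ⟨hzS, ?_⟩
  obtain ⟨R, hR, hball⟩ := Metric.isOpen_iff.1 hS z hzS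
  obtain ⟨p, hp, hzp⟩ := Metric.mem_closure_iff.1 hz (R / 2) (by positivity)
  have hsub : Metric.closedBall p (R / 2) ⊆ S := fun x hx => hball <| by
    have : dist x z ≤ dist x p + dist p z := dist_triangle _ _ _
    rw [dist_comm] at hzp
    have hx' : dist x p ≤ R / 2 := hx
    exact Metric.mem_ball.2 (by linarith)
  obtain ⟨r, hr, hrb⟩ := Metric.nhds_basis_closedBall.mem_iff.1 (hopen.mem_nhds hp)
  exact pos_on_ball_of_pos_on_closedBall hC hr (hcont.mono hsub)
    (fun x hx => hd x (hsub (Metric.ball_subset_closedBall hx)))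
    (fun x hx => hl x (hsub (Metric.ball_subset_closedBall hx)))
    (fun x hx => h0 x (hsub hx)) (fun x hx => (hrb hx).2) z hzp

lemma exists_supporting_affine {S : Set E} (hS : IsOpen S) (hconv : Convex ℝ S)
    (hne : Sᶜ.Nonempty) {x : E} (hx : x ∈ S) :
    ∃ a : E, ‖a‖ = 1 ∧ ∃ c : ℝ, c - inner ℝ a x = Metric.infDist x Sᶜ ∧
      ∀ y ∈ S, Metric.infDist y Sᶜ ≤ c - inner ℝ a y := by
  obtain ⟨z, hz, hxz⟩ := hS.isClosed_compl.exists_infDist_eq_dist hne x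
  obtain ⟨φ, hφ⟩ := geometric_hahn_banach_open_point hconv hS hz
  obtain ⟨a₀, ha₀⟩ := (InnerProductSpace.toDual ℝ E).surjective φ
  have hφa : ∀ y ∈ S, inner ℝ a₀ y < inner ℝ a₀ z := by
    intro y hy
    have := hφ y hy
    rwa [← ha₀, toDual_apply_apply, toDual_apply_apply] at this
  have ha0 : a₀ ≠ 0 := by
    rintro rfl
    simpa using hφa x hx
  have hn : 0 < ‖a₀‖ := norm_pos_iff.2 ha0
  set a := ‖a₀‖⁻¹ • a₀ with ha
  have ha1 : ‖a‖ = 1 := by rw [ha, norm_smul, norm_inv, norm_norm, inv_mul_cancel₀ hn.ne']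
  have hlt : ∀ y ∈ S, inner ℝ a y < inner ℝ a z := by
    intro y hy
    rw [ha, real_inner_smul_left, real_inner_smul_left]
    exact mul_lt_mul_of_pos_left (hφa y hy) (by positivity)
  have hle : ∀ y ∈ S, Metric.infDist y Sᶜ ≤ inner ℝ a z - inner ℝ a y := by
    intro y hy
    have hmem : y + (inner ℝ a z - inner ℝ a y) • a ∈ Sᶜ := by
      intro hmem
      have := hlt _ hmem
      rw [inner_add_right, inner_smul_right, real_inner_self_eq_norm_sq, ha1] at this
      simp at this
    refine (Metric.infDist_le_dist_of_mem hmem).trans ?_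
    rw [dist_self_add_right, norm_smul, ha1, mul_one, Real.norm_of_nonneg]
    linarith [hlt y hy]
  refine ⟨a, ha1, inner ℝ a z, le_antisymm ?_ (hle x hx), hle⟩
  rw [hxz, dist_comm, dist_eq_norm, ← inner_sub_right]
  exact (real_inner_le_norm _ _).trans (by rw [ha1, one_mul])

/-- Maximum principle near the boundary of a bounded convex set. -/
lemma nonneg_of_nonneg_away_from_boundary {S : Set E} (hS : IsOpen S) (hconv : Convex ℝ S)
    (hb : Bornology.IsBounded S) (hne : Sᶜ.Nonempty) {w : E → ℝ} (hcont : ContinuousOn w (closure S))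
    {C A : ℝ} (hC : 0 ≤ C) (hA : 1 ≤ A) (hCA : C < A)
    (hd : ∀ x ∈ S, ContDiffAt ℝ 2 w x) (hl : ∀ x ∈ S, w x < 0 → Δ w x ≤ C * (-w x))
    (hbd : ∀ x ∈ frontier S, 0 ≤ w x)
    (hδ : ∀ x ∈ S, 1 / (2 * A) ≤ Metric.infDist x Sᶜ → 0 ≤ w x) :
    ∀ x ∈ S, 0 ≤ w x := by
  intro x₁ hx₁
  by_contra! hneg₁
  set δ := 1 / (2 * A) with hδdef
  have hAδ : A * δ = 1 / 2 := by rw [hδdef]; field_simp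
  have hδ0 : 0 < δ := by positivity
  set d : E → ℝ := fun x => Metric.infDist x Sᶜ with hddef
  have hdc : Continuous d := Metric.continuous_infDist_pt _
  have hd0 : ∀ x, 0 ≤ d x := fun x => Metric.infDist_nonneg
  let φ : ℝ → ℝ := fun s => 1 + s - A * s ^ 2
  have hφ1 : ∀ s, 0 ≤ s → s ≤ δ → 1 ≤ φ s := by
    intro s hs hs'
    simp only [φ]
    nlinarith [mul_le_mul_of_nonneg_left hs' (show 0 ≤ A by linarith)]
  have hφ2 : ∀ s, φ s ≤ 2 := by
    intro s
    simp only [φ]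
    nlinarith [sq_nonneg (s - 1 / 2), sq_nonneg s]
  have hφmono : ∀ s t, 0 ≤ s → s ≤ t → t ≤ δ → φ s ≤ φ t := by
    intro s t hs hst ht
    have : A * (t + s) ≤ 1 := by nlinarith
    simp only [φ]
    nlinarith
  have hφc : ContDiff ℝ 2 φ := by fun_prop
  set T := closure S ∩ {x | d x ≤ δ} with hT
  have hTc : IsCompact T :=
    (hb.isCompact_closure).inter_right (isClosed_le hdc continuous_const)
  have hdpos : ∀ x ∈ T, 0 < φ (d x) := fun x hx => by linarith [hφ1 _ (hd0 x) hx.2]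
  have hqc : ContinuousOn (fun x => w x / φ (d x)) T :=
    (hcont.mono Set.inter_subset_left).div (hφc.continuous.comp hdc).continuousOn
      fun x hx => (hdpos x hx).ne'
  have hx₁T : x₁ ∈ T := by
    refine ⟨subset_closure hx₁, ?_⟩
    by_contra h
    have := hδ x₁ hx₁ (by simp at h; exact h.le)
    linarith
  obtain ⟨x₀, hx₀T, hx₀min⟩ := hTc.exists_isMinOn ⟨x₁, hx₁T⟩ hqc
  have hq₁ : w x₁ / φ (d x₁) < 0 := div_neg_of_neg_of_pos hneg₁ (hdpos _ hx₁T)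
  have hq₀ : w x₀ / φ (d x₀) < 0 := lt_of_le_of_lt (hx₀min hx₁T) hq₁
  set t := -(w x₀ / φ (d x₀)) with ht
  have ht0 : 0 < t := by linarith
  have hw₀ : w x₀ = -t * φ (d x₀) := by
    rw [ht, neg_neg, div_mul_cancel₀ _ (hdpos _ hx₀T).ne']
  have hw₀neg : w x₀ < 0 := by
    rw [hw₀]; nlinarith [hdpos _ hx₀T]
  have hx₀S : x₀ ∈ S := by
    by_contra h
    have : x₀ ∈ frontier S := by
      rw [hS.frontier_eq]; exact ⟨hx₀T.1, h⟩
    linarith [hbd _ this]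
  have hd₀ : d x₀ < δ := by
    by_contra! h
    linarith [hδ _ hx₀S h]
  obtain ⟨a, ha1, c, hc, hle⟩ := exists_supporting_affine hS hconv hne hx₀S
  let F : ℝ → ℝ := fun s => t * φ s
  let F' : ℝ → ℝ := fun s => t * (1 - 2 * A * s)
  have hF1 : ∀ s, HasDerivAt F (F' s) s := by
    intro s
    have := ((((hasDerivAt_id s).const_add 1).sub ((hasDerivAt_pow 2 s).const_mul A)).const_mul t)
    refine this.congr_deriv ?_
    simp only [F', Nat.cast_ofNat, Nat.add_one_sub_one, pow_one]; ring
  have hF2 : ∀ s, HasDerivAt F' (-(2 * A * t)) s := by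
    intro s
    have := (((hasDerivAt_id s).const_mul (2 * A)).const_sub 1).const_mul t
    refine this.congr_deriv ?_
    ring
  have hFc : ContDiff ℝ 2 F := contDiff_const.mul hφc
  let G : E → ℝ := fun y => F (c - inner ℝ a y)
  have hlc : ContDiff ℝ 2 fun y => c - inner ℝ a y :=
    contDiff_const.sub (contDiff_const.inner ℝ contDiff_id)
  have hGc : ContDiff ℝ 2 G := hFc.comp hlc
  have hmin : IsLocalMin (w + G) x₀ := by
    have e1 : ∀ᶠ y in 𝓝 x₀, y ∈ S := hS.mem_nhds hx₀S
    have e2 : ∀ᶠ y in 𝓝 x₀, c - inner ℝ a y < δ :=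
      hlc.continuous.continuousAt.eventually_lt_const (hc.trans_lt hd₀)
    filter_upwards [e1, e2] with y hyS hy
    have hdy : d y ≤ c - inner ℝ a y := hle y hyS
    have hyT : y ∈ T := ⟨subset_closure hyS, hdy.trans hy.le⟩
    have h1 : -t ≤ w y / φ (d y) := by
      rw [ht, neg_neg]; exact hx₀min hyT
    rw [le_div_iff₀ (hdpos _ hyT)] at h1
    have h2 := hφmono _ _ (hd0 y) hdy hy.le
    have h3 : (w + G) x₀ = 0 := by
      simp only [Pi.add_apply, G, F, hc]
      rw [hw₀]; simp only [d]; ring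
    rw [h3]
    simp only [Pi.add_apply, G, F]
    nlinarith
  have h1 : 0 ≤ Δ (w + G) x₀ :=
    laplacian_nonneg_of_isLocalMin ((hd x₀ hx₀S).add hGc.contDiffAt) hmin
  rw [(hd x₀ hx₀S).laplacian_add hGc.contDiffAt] at h1
  have h2 : Δ G x₀ = _ := laplacian_comp_inner a ha1 hFc hF1 (hF2 (c - inner ℝ a x₀))
  rw [h2] at h1
  have h3 := hl x₀ hx₀S hw₀neg
  rw [hw₀] at h3
  have h4 := hφ2 (d x₀)
  have h5 : C * (t * φ (d x₀)) ≤ C * (t * 2) := by gcongr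
  nlinarith

end MaximumPrinciples

section MovingPlanes

variable {E : Type*} [NormedAddCommGroup E] [InnerProductSpace ℝ E]

/-- Reflection across the hyperplane `{y | ⟪e, y⟫ = μ}`, for a unit vector `e`. -/
def planeReflection (e : E) (μ : ℝ) (x : E) : E := x + (2 * (μ - inner ℝ e x)) • e

lemma continuous_planeReflection (e : E) :
    Continuous fun q : ℝ × E => planeReflection e q.1 q.2 := by
  unfold planeReflection
  fun_prop

lemma planeReflection_of_inner_eq {e : E} {μ : ℝ} {x : E} (h : inner ℝ e x = μ) :
    planeReflection e μ x = x := by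
  simp [planeReflection, h]

lemma planeReflection_eq_reflection {e : E} (he : ‖e‖ = 1) (μ : ℝ) (x : E) :
    planeReflection e μ x = (ℝ ∙ e)ᗮ.reflection x + (2 * μ) • e := by
  rw [Submodule.reflection_orthogonal_apply, Submodule.reflection_singleton_apply, he,
    planeReflection]
  simp only [RCLike.ofReal_one, one_pow, div_one]
  module

variable [FiniteDimensional ℝ E]

lemma laplacian_comp_planeReflection {e : E} (he : ‖e‖ = 1) (μ : ℝ) {G : E → ℝ} {x : E}
    (hG : ContDiffAt ℝ 2 G (planeReflection e μ x)) :
    Δ (fun y => G (planeReflection e μ y)) x = Δ G (planeReflection e μ x) := by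
  simp only [planeReflection_eq_reflection he] at hG ⊢
  exact laplacian_comp_isometry _ _ hG

/-- The moving planes method in a bounded convex set, for the extension by zero of a positive
solution of a semilinear equation. -/
lemma le_comp_planeReflection {Ω : Set E} (hΩ : IsOpen Ω) (hconv : Convex ℝ Ω)
    (hb : Bornology.IsBounded Ω) {v : E → ℝ} (hv : Continuous v) (hv0 : ∀ x ∉ Ω, v x = 0)
    (hvpos : ∀ x ∈ Ω, 0 < v x) (hd : ∀ x ∈ Ω, ContDiffAt ℝ 2 v x) {f : ℝ → ℝ} {K : ℝ}
    (hK : 0 ≤ K) (hf : ∀ x ∈ Ω, ∀ y ∈ Ω, |f (v x) - f (v y)| ≤ K * |v x - v y|)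
    (heq : ∀ x ∈ Ω, Δ v x + f (v x) = 0) {e : E} (he : ‖e‖ = 1) {M ε : ℝ}
    (hM : ∀ x ∈ closure Ω, inner ℝ e x ≤ M) {p : E} (hp : p ∈ closure Ω) (hpM : inner ℝ e p = M)
    (hpΩ : p ∉ Ω)
    (hcap : ∀ x ∈ closure Ω, M - ε < inner ℝ e x → ∀ t, 0 < t → t ≤ 2 * ε → x - t • e ∈ Ω)
    {μ : ℝ} (hμ : M - ε ≤ μ) {x : E} (hx : x ∈ Ω) (hxμ : μ ≤ inner ℝ e x) :
    v x ≤ v (planeReflection e μ x) := by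
  have hv_nonneg : ∀ x, 0 ≤ v x := fun x => by
    by_cases h : x ∈ Ω
    · exact (hvpos x h).le
    · exact (hv0 x h).ge
  let S : ℝ → Set E := fun μ => Ω ∩ {x | μ < inner ℝ e x}
  let w : ℝ → E → ℝ := fun μ x => v (planeReflection e μ x) - v x
  have hinner : Continuous fun x : E => (inner ℝ e x : ℝ) := by fun_prop
  have hSo : ∀ μ, IsOpen (S μ) := fun μ => hΩ.inter (isOpen_lt continuous_const hinner)
  have hSconv : ∀ μ, Convex ℝ (S μ) := fun μ =>
    hconv.inter (convex_halfSpace_gt (innerSL ℝ e).toLinearMap.isLinear μ)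
  have hrc : ∀ μ, Continuous (planeReflection e μ) := fun μ =>
    (continuous_planeReflection e).comp (by fun_prop : Continuous fun x : E => (μ, x))
  have hwc : ∀ μ, Continuous (w μ) := fun μ => (hv.comp (hrc μ)).sub hv
  have hrefl : ∀ μ, M - ε ≤ μ → ∀ x ∈ closure Ω, μ < inner ℝ e x → planeReflection e μ x ∈ Ω := by
    intro μ hμ x hx hxμ
    have := hcap x hx (by linarith) (2 * (inner ℝ e x - μ)) (by linarith)
      (by linarith [hM x hx])
    convert this using 1
    rw [planeReflection]
    module
  have hwd : ∀ μ, M - ε ≤ μ → ∀ x ∈ S μ, ContDiffAt ℝ 2 (w μ) x ∧ |Δ (w μ) x| ≤ K * |w μ x| := by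
    intro μ hμ x hx
    have hx' := hrefl μ hμ x (subset_closure hx.1) hx.2
    have h1 : ContDiffAt ℝ 2 (fun y => v (planeReflection e μ y)) x := by
      refine ContDiffAt.comp x (hd _ hx') ?_
      unfold planeReflection
      exact (contDiff_id.add ((contDiff_const.mul (contDiff_const.sub
        (contDiff_const.inner ℝ contDiff_id))).smul contDiff_const)).contDiffAt
    refine ⟨h1.sub (hd x hx.1), ?_⟩
    have h2 : Δ (w μ) x = Δ v (planeReflection e μ x) - Δ v x := by
      rw [← laplacian_comp_planeReflection he μ (hd _ hx')]
      exact h1.laplacian_sub (hd x hx.1)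
    have h3 : Δ (w μ) x = -(f (v (planeReflection e μ x)) - f (v x)) := by
      rw [h2]; linarith [heq _ hx', heq _ hx.1]
    rw [h3, abs_neg]
    exact hf _ hx' _ hx.1
  have hpos : ∀ μ, M - ε ≤ μ → (∀ x ∈ S μ, 0 ≤ w μ x) → ∀ x ∈ S μ, 0 < w μ x := by
    intro μ hμ h0 x hx
    have hμM : μ < M := lt_of_lt_of_le hx.2 (hM x (subset_closure hx.1))
    have hpw : 0 < w μ p := by
      simp only [w, hv0 p hpΩ, sub_zero]
      exact hvpos _ (hrefl μ hμ p hp (by rw [hpM]; exact hμM))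
    have hopen : IsOpen {y | μ < inner ℝ e y ∧ 0 < w μ y} :=
      (isOpen_lt continuous_const hinner).inter (isOpen_lt continuous_const (hwc μ))
    obtain ⟨y, ⟨hy1, hy2⟩, hyΩ⟩ := mem_closure_iff.1 hp _ hopen ⟨by rw [hpM]; exact hμM, hpw⟩
    refine pos_of_preconnected (hSo μ) (hSconv μ).isPreconnected hK
      (fun x hx => (hwd μ hμ x hx).1) (fun x hx => ?_) h0 (y := y) ⟨hyΩ, hy1⟩ hy2 x hx
    have := (hwd μ hμ x hx).2
    rw [abs_of_nonneg (h0 x hx)] at this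
    exact (le_abs_self _).trans this
  set δ := 1 / (2 * (K + 1)) with hδ
  have hδ0 : 0 < δ := by positivity
  have hnarrow : ∀ μ, M - ε ≤ μ →
      (∀ x ∈ Ω, δ ≤ Metric.infDist x Ωᶜ → δ ≤ inner ℝ e x - μ → 0 ≤ w μ x) →
      ∀ x ∈ S μ, 0 ≤ w μ x := by
    intro μ hμ h
    refine nonneg_of_nonneg_away_from_boundary (hSo μ) (hSconv μ)
      (hb.subset Set.inter_subset_left) ⟨p, fun h => hpΩ h.1⟩ (hwc μ).continuousOn hK
      (by linarith) (lt_add_one K) (fun x hx => (hwd μ hμ x hx).1) ?_ ?_ ?_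
    · intro x hx hneg
      have := (hwd μ hμ x hx).2
      rw [abs_of_neg hneg] at this
      exact (le_abs_self _).trans this
    · intro x hx
      have hxS : x ∉ S μ := by rw [(hSo μ).frontier_eq] at hx; exact hx.2
      by_cases hxΩ : x ∈ Ω
      · have h1 : inner ℝ e x ≤ μ := not_lt.1 fun h => hxS ⟨hxΩ, h⟩
        have h2 : μ ≤ inner ℝ e x := by
          have : closure (S μ) ⊆ {x | μ ≤ inner ℝ e x} :=
            closure_minimal (fun y hy => (le_of_lt hy.2 : μ ≤ inner ℝ e y))
              (isClosed_le continuous_const hinner)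
          exact this hx.1
        simp [w, planeReflection_of_inner_eq (le_antisymm h1 h2)]
      · simp only [w, hv0 x hxΩ, sub_zero]
        exact hv_nonneg _
    · intro x hx hxδ
      refine h x hx.1 (hxδ.trans ?_) (hxδ.trans ?_)
      · exact Metric.infDist_le_infDist_of_subset
          (Set.compl_subset_compl.2 Set.inter_subset_left) ⟨p, hpΩ⟩
      · have hmem : x - (inner ℝ e x - μ) • e ∈ (S μ)ᶜ := by
          intro h
          have := h.2
          simp [inner_sub_right, inner_smul_right, he] at this
        refine (Metric.infDist_le_dist_of_mem hmem).trans ?_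
        rw [dist_self_sub_right, norm_smul, he, mul_one, Real.norm_of_nonneg]
        linarith [hx.2.out]
  have hall : Set.Icc 0 ε ⊆ {s | ∀ x ∈ S (M - s), 0 ≤ w (M - s) x} := by
    refine IsClosed.Icc_subset_of_forall_exists_gt (IsClosed.inter ?_ isClosed_Icc) ?_ ?_
    · have : {s | ∀ x ∈ S (M - s), 0 ≤ w (M - s) x}
          = ⋂ x ∈ Ω, ({s | inner ℝ e x ≤ M - s} ∪ {s | 0 ≤ w (M - s) x}) := by
        ext s
        simp only [Set.mem_ofPred_eq, Set.mem_iInter, Set.mem_union, S, Set.mem_inter_iff]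
        refine forall_congr' fun x => ?_
        rw [and_imp]
        refine imp_congr_right fun _ => ?_
        rw [← not_lt (a := M - s), imp_iff_not_or]
      rw [this]
      refine isClosed_biInter fun x _ => IsClosed.union (isClosed_le (by fun_prop) (by fun_prop))
        (isClosed_le continuous_const ?_)
      exact (hv.comp ((continuous_planeReflection e).comp
        (by fun_prop : Continuous fun s : ℝ => (M - s, x)))).sub continuous_const
    · intro x hx
      have h1 := hM x (subset_closure hx.1)
      have h2 : M - 0 < inner ℝ e x := hx.2
      linarith
    · rintro s ⟨hs, hs0, hsε⟩ y hy
      let Z : Set (ℝ × E) := (Set.Icc 0 ε ×ˢ closure Ω) ∩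
        ({q | δ ≤ Metric.infDist q.2 Ωᶜ} ∩ {q | δ ≤ inner ℝ e q.2 - (M - q.1)} ∩
          {q | w (M - q.1) q.2 ≤ 0})
      have hwc' : Continuous fun q : ℝ × E => w (M - q.1) q.2 :=
        (hv.comp ((continuous_planeReflection e).comp
          (by fun_prop : Continuous fun q : ℝ × E => (M - q.1, q.2)))).sub (hv.comp continuous_snd)
      have hZ : IsCompact Z := by
        refine (isCompact_Icc.prod hb.isCompact_closure).inter_right ?_
        refine ((isClosed_le continuous_const
          ((Metric.continuous_infDist_pt _).comp continuous_snd)).inter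
          (isClosed_le continuous_const (by fun_prop))).inter (isClosed_le hwc' continuous_const)
      have hmemΩ : ∀ x, δ ≤ Metric.infDist x Ωᶜ → x ∈ Ω := by
        intro x hx
        by_contra h
        rw [Metric.infDist_zero_of_mem (show x ∈ Ωᶜ from h)] at hx
        linarith
      have hsZ : s ∉ Prod.fst '' Z := by
        rintro ⟨⟨s', x⟩, ⟨-, ⟨h1, h2⟩, h3⟩, rfl⟩
        have h2' : δ ≤ inner ℝ e x - (M - s') := h2
        have h3' : w (M - s') x ≤ 0 := h3
        have h4 : M - s' < inner ℝ e x := by linarith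
        have h5 : s' < ε := hsε
        have := hpos (M - s') (by linarith) hs x ⟨hmemΩ x h1, h4⟩
        linarith
      have hev : ∀ᶠ s' in 𝓝[>] s, s' ∉ Prod.fst '' Z :=
        nhdsWithin_le_nhds ((hZ.image continuous_fst).isClosed.isOpen_compl.mem_nhds hsZ)
      have hev2 : ∀ᶠ s' in 𝓝[>] s, s' ∈ Set.Ioc s (min y ε) :=
        Ioc_mem_nhdsGT (lt_min hy hsε)
      obtain ⟨s', hs'Z, hs'⟩ := (hev.and hev2).exists
      have hs'ε : s' ≤ ε := hs'.2.trans (min_le_right _ _)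
      refine ⟨s', ?_, hs'.1, hs'.2.trans (min_le_left _ _)⟩
      refine hnarrow (M - s') (by linarith) fun x hx h1 h2 => ?_
      by_contra! hneg
      exact hs'Z ⟨(s', x), ⟨⟨⟨hs0.trans hs'.1.le, hs'ε⟩, subset_closure hx⟩, ⟨h1, h2⟩, hneg.le⟩, rfl⟩
  rcases hxμ.eq_or_lt with h | h
  · rw [planeReflection_of_inner_eq h.symm]
  · have hμM : μ < M := h.trans_le (hM x (subset_closure hx))
    have := hall (show M - μ ∈ Set.Icc 0 ε from ⟨by linarith, by linarith⟩)
    rw [Set.mem_ofPred_eq, sub_sub_cancel] at this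
    simpa [w] using this x ⟨hx, h⟩

end MovingPlanes

section ConvexGeometry

variable {E : Type*} [NormedAddCommGroup E] [InnerProductSpace ℝ E]

lemma hasDerivAt_comp_line_zero [CompleteSpace E] {ρ : E → ℝ} {p v : E}
    (hρ : DifferentiableAt ℝ ρ p) :
    HasDerivAt (fun t : ℝ => ρ (p + t • v)) (inner ℝ (gradient ρ p) v) 0 := by
  have h : HasFDerivAt ρ (InnerProductSpace.toDual ℝ E (gradient ρ p)) (p + (0 : ℝ) • v) := by
    rw [zero_smul, add_zero]
    exact hρ.hasGradientAt.hasFDerivAt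
  exact h.comp_hasDerivAt (0 : ℝ) (hasDerivAt_line p v 0)

lemma exists_add_smul_neg_of_inner_gradient_neg [CompleteSpace E] {ρ : E → ℝ} {p v : E}
    (hρ : DifferentiableAt ℝ ρ p) (hp : ρ p = 0) (hv : inner ℝ (gradient ρ p) v < 0) :
    ∃ t : ℝ, 0 < t ∧ ρ (p + t • v) < 0 := by
  have h2 := (hasDerivAt_iff_tendsto_slope.1 (hasDerivAt_comp_line_zero (v := v) hρ)).mono_left
    (nhdsWithin_mono (0 : ℝ) fun t (ht : t ∈ Set.Ioi (0 : ℝ)) => (ne_of_gt ht : t ≠ 0))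
  obtain ⟨t, ht, ht0⟩ := ((h2.eventually_lt_const hv).and self_mem_nhdsWithin).exists
  refine ⟨t, ht0, ?_⟩
  have ht0' : (0 : ℝ) < t := ht0
  rw [slope_def_field, sub_zero, zero_smul, add_zero, hp, sub_zero] at ht
  exact neg_of_div_neg_left ht ht0'.le

lemma inner_gradient_nonpos [CompleteSpace E] {Ω : Set E} (hconv : Convex ℝ Ω) (hΩ : IsOpen Ω)
    {ρ : E → ℝ} {p : E} (hρ : DifferentiableAt ℝ ρ p) (hp : ρ p = 0) (hpc : p ∈ closure Ω)
    (hneg : ∀ x ∈ Ω, ρ x < 0) {y : E} (hy : y ∈ closure Ω) :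
    inner ℝ (gradient ρ p) (y - p) ≤ 0 := by
  have key : Ω ⊆ {y | inner ℝ (gradient ρ p) (y - p) ≤ 0} := by
    intro y hy
    have h2 := (hasDerivAt_iff_tendsto_slope.1 (hasDerivAt_comp_line_zero (v := y - p) hρ)).mono_left
      (nhdsWithin_mono (0 : ℝ) fun t (ht : t ∈ Set.Ioi (0 : ℝ)) => (ne_of_gt ht : t ≠ 0))
    refine le_of_tendsto h2 ?_
    filter_upwards [Ioc_mem_nhdsGT (zero_lt_one (α := ℝ))] with t ht
    rw [slope_def_field, sub_zero, zero_smul, add_zero, hp, sub_zero]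
    refine div_nonpos_of_nonpos_of_nonneg (hneg _ ?_).le ht.1.le
    have := hconv.combo_closure_interior_mem_interior hpc (by rwa [hΩ.interior_eq])
      (sub_nonneg.2 ht.2) ht.1 (sub_add_cancel 1 t)
    rw [hΩ.interior_eq] at this
    convert this using 1
    module
  exact closure_minimal key (isClosed_le (by fun_prop) continuous_const) hy

lemma exists_sub_smul_mem_of_isMax [CompleteSpace E] {Ω : Set E} {ρ : E → ℝ} {p : E}
    (hρ : DifferentiableAt ℝ ρ p) (hp : ρ p = 0) (hg : gradient ρ p ≠ 0)
    (hΩρ : Ω = {x | ρ x < 0}) {e : E} (he : ‖e‖ = 1)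
    (hmax : ∀ y ∈ closure Ω, inner ℝ e y ≤ inner ℝ e p) :
    ∃ t : ℝ, 0 < t ∧ p - t • e ∈ Ω := by
  set g := gradient ρ p with hgdef
  have hmem : ∀ v, inner ℝ g v < 0 → ∃ t : ℝ, 0 < t ∧ p + t • v ∈ Ω := by
    intro v hv
    rw [hΩρ]
    exact exists_add_smul_neg_of_inner_gradient_neg hρ hp hv
  have hgg : 0 < ‖g‖ := norm_pos_iff.2 hg
  have hge : 0 < inner ℝ g e := by
    by_contra! hle
    obtain ⟨t, ht, htΩ⟩ := hmem (e - g) (by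
      rw [inner_sub_right, real_inner_self_eq_norm_sq]; nlinarith)
    have := hmax _ (subset_closure htΩ)
    rw [inner_add_right, inner_smul_right, inner_sub_right, real_inner_self_eq_norm_sq, he,
      real_inner_comm g e] at this
    nlinarith [mul_nonneg ht.le (neg_nonneg.2 hle)]
  obtain ⟨t, ht, htΩ⟩ := hmem (-e) (by rw [inner_neg_right]; linarith)
  exact ⟨t, ht, by simpa [sub_eq_add_neg] using htΩ⟩

/-- Caps of uniform width of a convex domain with `C¹` boundary reflect into the domain. -/
lemma exists_uniform_cap [FiniteDimensional ℝ E] {Ω : Set E} (hΩ : IsOpen Ω) (hconv : Convex ℝ Ω)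
    (hb : Bornology.IsBounded Ω) {ρ : E → ℝ} (hρ : Differentiable ℝ ρ) (hΩρ : Ω = {x | ρ x < 0})
    (hfr : frontier Ω = {x | ρ x = 0}) (hg : ∀ x ∈ frontier Ω, gradient ρ x ≠ 0) :
    ∃ ε : ℝ, 0 < ε ∧ ∀ e : E, ‖e‖ = 1 → ∀ x ∈ closure Ω,
      (∀ y ∈ closure Ω, inner ℝ e y - ε ≤ inner ℝ e x) →
      ∀ t, 0 < t → t ≤ 2 * ε → x - t • e ∈ Ω := by
  by_contra! hcon
  choose e he x hx hmax t ht0 ht hnot using fun k : ℕ => hcon (1 / ((k : ℝ) + 1)) (by positivity)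
  have hcomp : IsCompact (Metric.sphere (0 : E) 1 ×ˢ closure Ω) :=
    (isCompact_sphere 0 1).prod hb.isCompact_closure
  obtain ⟨⟨e₀, x₀⟩, ⟨he₀, hx₀⟩, φ, hφ, hlim⟩ := hcomp.tendsto_subseq
    (x := fun k => (e k, x k)) fun k => ⟨by simpa using he k, hx k⟩
  have hle : Tendsto (fun k => e (φ k)) atTop (𝓝 e₀) := (continuous_fst.tendsto _).comp hlim
  have hlx : Tendsto (fun k => x (φ k)) atTop (𝓝 x₀) := (continuous_snd.tendsto _).comp hlim
  have hε : Tendsto (fun k => 1 / ((φ k : ℝ) + 1)) atTop (𝓝 0) :=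
    tendsto_one_div_add_atTop_nhds_zero_nat.comp hφ.tendsto_atTop
  have hmax₀ : ∀ y ∈ closure Ω, inner ℝ e₀ y ≤ inner ℝ e₀ x₀ := by
    intro y hy
    have h1 : Tendsto (fun k => inner ℝ (e (φ k)) y - 1 / ((φ k : ℝ) + 1)) atTop
        (𝓝 (inner ℝ e₀ y - 0)) := (hle.inner tendsto_const_nhds).sub hε
    rw [sub_zero] at h1
    exact le_of_tendsto_of_tendsto' h1 (hle.inner hlx) fun k => hmax (φ k) y hy
  obtain ⟨s, hs, hsΩ⟩ : ∃ s : ℝ, 0 < s ∧ x₀ - s • e₀ ∈ Ω := by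
    by_cases hxΩ : x₀ ∈ Ω
    · have hc : ContinuousAt (fun s : ℝ => x₀ - s • e₀) 0 := by fun_prop
      have hev : ∀ᶠ s in 𝓝[>] (0 : ℝ), x₀ - s • e₀ ∈ Ω :=
        nhdsWithin_le_nhds (hc.eventually (hΩ.mem_nhds (by simpa using hxΩ)))
      obtain ⟨s, h1, h2⟩ := (hev.and self_mem_nhdsWithin).exists
      exact ⟨s, h2, h1⟩
    · have hxf : x₀ ∈ frontier Ω := by rw [hΩ.frontier_eq]; exact ⟨hx₀, hxΩ⟩
      have hρ0 : ρ x₀ = 0 := by rw [hfr] at hxf; exact hxf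
      exact exists_sub_smul_mem_of_isMax (hρ x₀) hρ0 (hg _ hxf) hΩρ (by simpa using he₀) hmax₀
  have hev1 : ∀ᶠ k in atTop, x (φ k) - s • e (φ k) ∈ Ω :=
    (hlx.sub (hle.const_smul s)).eventually (hΩ.mem_nhds hsΩ)
  have hev2 : ∀ᶠ k in atTop, 1 / ((φ k : ℝ) + 1) < s / 2 := hε.eventually_lt_const (by positivity)
  obtain ⟨k, hk1, hk2⟩ := (hev1.and hev2).exists
  have hts : t (φ k) < s := by linarith [ht (φ k)]
  refine hnot (φ k) ?_
  have := hconv.combo_closure_interior_mem_interior (hx (φ k)) (by rwa [hΩ.interior_eq])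
    (a := 1 - t (φ k) / s) (b := t (φ k) / s) (sub_nonneg.2 ((div_le_one hs).2 hts.le))
    (div_pos (ht0 _) hs) (sub_add_cancel 1 _)
  rw [hΩ.interior_eq] at this
  convert this using 1
  rw [smul_sub, smul_smul, div_mul_cancel₀ _ hs.ne']
  module

end ConvexGeometry

section BoundaryEstimate

lemma exists_eq_sub_smul_of_mem_ball {E : Type*} [NormedAddCommGroup E] [InnerProductSpace ℝ E]
    {s : Set E} {R ε r : ℝ} (hε : 0 < ε) (hR : ∀ y ∈ s, ‖y‖ ≤ R) (hr : r ≤ ε / 4)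
    (hrR : 32 * R * r ≤ ε ^ 2) {ν x x₀ z : E} (hν : ‖ν‖ = 1)
    (hs : ∀ y ∈ s, inner ℝ ν (y - x₀) ≤ 0) (hx : x ∈ s) (hxx₀ : dist x x₀ ≤ ε / 8)
    (hz : z ∈ Metric.ball (x - (ε / 2) • ν) r) :
    ∃ (e : E) (t : ℝ), ‖e‖ = 1 ∧ ε / 4 ≤ t ∧ t ≤ ε ∧ z = x - t • e ∧
      ∀ y ∈ s, inner ℝ e y - ε / 2 ≤ inner ℝ e x := by
  set b := x - (ε / 2) • ν - z with hb
  have hbr : ‖b‖ < r := by rwa [Metric.mem_ball, dist_comm, dist_eq_norm] at hz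
  have hw : x - z = (ε / 2) • ν + b := by rw [hb]; abel
  have hν2 : ‖(ε / 2) • ν‖ = ε / 2 := by
    rw [norm_smul, hν, mul_one, Real.norm_of_nonneg (by positivity)]
  have ht1 : ε / 4 ≤ ‖x - z‖ := by
    have := norm_sub_le_norm_add ((ε / 2) • ν) b
    rw [hw]; linarith
  have ht2 : ‖x - z‖ ≤ ε := by
    have := norm_add_le ((ε / 2) • ν) b
    rw [hw]; linarith
  have ht0 : 0 < ‖x - z‖ := by linarith
  refine ⟨‖x - z‖⁻¹ • (x - z), ‖x - z‖, ?_, ht1, ht2, ?_, fun y hy => ?_⟩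
  · rw [norm_smul, norm_inv, norm_norm, inv_mul_cancel₀ ht0.ne']
  · rw [smul_inv_smul₀ ht0.ne', sub_sub_cancel]
  · have h1 : inner ℝ ν (x₀ - x) ≤ ε / 8 := by
      refine (real_inner_le_norm _ _).trans ?_
      rwa [hν, one_mul, ← dist_eq_norm, dist_comm]
    have h2 : inner ℝ b (y - x) ≤ r * (2 * R) := by
      refine (real_inner_le_norm _ _).trans ?_
      have h3 : ‖y - x‖ ≤ 2 * R := by
        have := norm_sub_le y x
        linarith [hR y hy, hR x hx]
      exact mul_le_mul hbr.le h3 (norm_nonneg _) ((norm_nonneg _).trans hbr.le)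
    have h4 : inner ℝ ν (y - x) ≤ ε / 8 := by
      have : y - x = (y - x₀) + (x₀ - x) := by abel
      rw [this, inner_add_right]
      linarith [hs y hy]
    have h5 : inner ℝ (x - z) (y - x) ≤ ‖x - z‖ * (ε / 2) := by
      rw [hw, inner_add_left, inner_smul_left, ← hw]
      simp only [conj_trivial]
      nlinarith
    have h6 : ‖x - z‖⁻¹ * inner ℝ (x - z) (y - x) ≤ ε / 2 := by
      rwa [inv_mul_le_iff₀ ht0]
    rw [inner_sub_right] at h6
    simp only [inner_smul_left, conj_trivial]
    linarith

variable {n : ℕ} {Ω : Set (EuclideanSpace ℝ (Fin n))}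

/-- The moving plane comparison for classical solutions, for caps of uniform width `ε`. -/
lemma IsClassicalSol.le_sub_smul (hΩ : IsOpen Ω) (hconv : Convex ℝ Ω)
    (hb : Bornology.IsBounded Ω) {ε : ℝ}
    (hcap : ∀ e : EuclideanSpace ℝ (Fin n), ‖e‖ = 1 → ∀ x ∈ closure Ω,
      (∀ y ∈ closure Ω, inner ℝ e y - ε ≤ inner ℝ e x) →
      ∀ t, 0 < t → t ≤ 2 * ε → x - t • e ∈ Ω)
    {f : ℝ → ℝ} (hf : LocallyLipschitz f) {u : EuclideanSpace ℝ (Fin n) → ℝ}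
    (hu : IsClassicalSol Ω f u) (hpos : ∀ x ∈ Ω, 0 < u x)
    {e : EuclideanSpace ℝ (Fin n)} (he : ‖e‖ = 1) {x : EuclideanSpace ℝ (Fin n)} (hx : x ∈ Ω)
    (hmax : ∀ y ∈ closure Ω, inner ℝ e y - ε / 2 ≤ inner ℝ e x) {t : ℝ} (ht0 : 0 < t)
    (ht : t ≤ ε) : u x ≤ u (x - t • e) := by
  obtain ⟨⟨U, hU, hΩU, huU⟩, heq, hbd⟩ := hu
  have hcompact : IsCompact (closure Ω) := hb.isCompact_closure
  have hcont : ContinuousOn u (closure Ω) := huU.continuousOn.mono hΩU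
  have hv : Continuous (Ω.indicator u) := continuous_indicator hbd hcont
  have hvu : ∀ y ∈ Ω, Ω.indicator u y = u y := fun y hy => Set.indicator_of_mem hy u
  have hev : ∀ y ∈ Ω, Ω.indicator u =ᶠ[𝓝 y] u := fun y hy => by
    filter_upwards [hΩ.mem_nhds hy] with w hw using hvu w hw
  have hud : ∀ y ∈ Ω, ContDiffAt ℝ 2 u y := fun y hy =>
    huU.contDiffAt (hU.mem_nhds (hΩU (subset_closure hy)))
  obtain ⟨K, hK⟩ := (hf.locallyLipschitzOn (s := u '' closure Ω)).exists_lipschitzOnWith_of_compact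
    (hcompact.image_of_continuousOn hcont)
  obtain ⟨p, hp, hpmax⟩ := hcompact.exists_isMaxOn ⟨x, subset_closure hx⟩
    (f := fun y => inner ℝ e y) (by fun_prop)
  have hpmax' : ∀ y ∈ closure Ω, inner ℝ e y ≤ inner ℝ e p := fun y hy => hpmax hy
  have hpΩ : p ∉ Ω := by
    intro hpΩ
    have hc : ContinuousAt (fun s : ℝ => p + s • e) 0 := by fun_prop
    have hev : ∀ᶠ s in 𝓝[>] (0 : ℝ), p + s • e ∈ Ω :=
      nhdsWithin_le_nhds (hc.eventually (hΩ.mem_nhds (by simpa using hpΩ)))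
    obtain ⟨s, h1, h2⟩ := (hev.and self_mem_nhdsWithin).exists
    have h2' : (0 : ℝ) < s := h2
    have := hpmax' _ (subset_closure h1)
    rw [inner_add_right, inner_smul_right, real_inner_self_eq_norm_sq, he] at this
    linarith
  have hxt : x - t • e ∈ Ω :=
    hcap e he x (subset_closure hx) (fun y hy => by linarith [hmax y hy]) t ht0 (by linarith)
  have key := le_comp_planeReflection hΩ hconv hb hv (fun y hy => Set.indicator_of_notMem hy u)
    (fun y hy => by rw [hvu y hy]; exact hpos y hy)
    (fun y hy => (hud y hy).congr_of_eventuallyEq (hev y hy)) K.coe_nonneg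
    (fun y hy z hz => by
      have h := hK.dist_le_mul _ (Set.mem_image_of_mem u (subset_closure hy)) _
        (Set.mem_image_of_mem u (subset_closure hz))
      rwa [hvu y hy, hvu z hz, ← Real.dist_eq, ← Real.dist_eq])
    (fun y hy => by
      rw [(laplacian_congr_nhds (hev y hy)).eq_of_nhds, hvu y hy, ← lapl_eq_laplacian (hud y hy)]
      exact heq y hy)
    he hpmax' hp rfl hpΩ (ε := ε)
    (fun y hy hy' => hcap e he y hy fun z hz => by linarith [hpmax' z hz])
    (μ := inner ℝ e x - t / 2) (by linarith [hmax p hp]) hx (by linarith)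
  have hrefl : planeReflection e (inner ℝ e x - t / 2) x = x - t • e := by
    rw [planeReflection]; module
  rwa [hrefl, hvu x hx, hvu _ hxt] at key

/-- Near the boundary of a convex domain, positive solutions are dominated on a ball of fixed
radius. -/
lemma exists_ball_subset_le (hn : n ≠ 0) (hΩ : IsSmoothBoundedDomain Ω) (hconv : Convex ℝ Ω) :
    ∃ ρ r : ℝ, 0 < ρ ∧ 0 < r ∧ ∀ f : ℝ → ℝ, LocallyLipschitz f →
      ∀ u : EuclideanSpace ℝ (Fin n) → ℝ, IsClassicalSol Ω f u → (∀ x ∈ Ω, 0 < u x) →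
      ∀ x ∈ Ω, Metric.infDist x (frontier Ω) < ρ →
        ∃ c, Metric.ball c r ⊆ Ω ∧ ∀ y ∈ Metric.ball c r, u x ≤ u y := by
  have : NeZero n := ⟨hn⟩
  obtain ⟨hopen, hb, hne, ρ, hρ, hΩρ, hfr, hg⟩ := hΩ
  have hρd : Differentiable ℝ ρ := hρ.differentiable (by simp)
  obtain ⟨ε, hε, hcap⟩ := exists_uniform_cap hopen hconv hb hρd hΩρ hfr hg
  obtain ⟨R, hR0, hR⟩ := hb.closure.exists_pos_norm_le
  have hfne : (frontier Ω).Nonempty := by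
    refine nonempty_frontier_iff.2 ⟨hne, fun h => ?_⟩
    rw [h] at hb
    exact NormedSpace.unbounded_univ ℝ (EuclideanSpace ℝ (Fin n)) hb
  refine ⟨ε / 8, min (ε / 4) (ε ^ 2 / (32 * R)), by positivity, by positivity,
    fun f hf u hu hpos x hx hdist => ?_⟩
  obtain ⟨x₀, hx₀, hxx₀⟩ := (Metric.infDist_lt_iff hfne).1 hdist
  have hρ0 : ρ x₀ = 0 := by rw [hfr] at hx₀; exact hx₀
  have hneg : ∀ y ∈ Ω, ρ y < 0 := fun y hy => by rw [hΩρ] at hy; exact hy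
  have hg0 : gradient ρ x₀ ≠ 0 := hg x₀ hx₀
  set ν := ‖gradient ρ x₀‖⁻¹ • gradient ρ x₀ with hνdef
  have hν : ‖ν‖ = 1 := by
    rw [hνdef, norm_smul, norm_inv, norm_norm, inv_mul_cancel₀ (norm_ne_zero_iff.2 hg0)]
  have hsupp : ∀ y ∈ closure Ω, inner ℝ ν (y - x₀) ≤ 0 := fun y hy => by
    rw [hνdef, inner_smul_left]
    exact mul_nonpos_of_nonneg_of_nonpos (by simp)
      (inner_gradient_nonpos hconv hopen (hρd x₀) hρ0 (frontier_subset_closure hx₀) hneg hy)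
  have key : ∀ z ∈ Metric.ball (x - (ε / 2) • ν) (min (ε / 4) (ε ^ 2 / (32 * R))),
      z ∈ Ω ∧ u x ≤ u z := by
    intro z hz
    obtain ⟨e, t, he, ht1, ht2, rfl, hmax⟩ := exists_eq_sub_smul_of_mem_ball hε hR
      (min_le_left _ _) ((le_div_iff₀' (by positivity)).1 (min_le_right _ _)) hν hsupp
      (subset_closure hx) hxx₀.le hz
    have ht0 : 0 < t := by linarith
    exact ⟨hcap e he x (subset_closure hx) (fun y hy => by linarith [hmax y hy]) t ht0
      (by linarith), hu.le_sub_smul hopen hconv hb hcap hf hpos he hx hmax ht0 ht2⟩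
  exact ⟨_, fun z hz => (key z hz).1, fun z hz => (key z hz).2⟩

end BoundaryEstimate

end Auxiliary

/-- (Boundary estimate by moving planes in convex domains.) -/
theorem moving_planes_boundary_estimate
    (n : ℕ) (hn : 2 ≤ n)
    (Ω : Set (EuclideanSpace ℝ (Fin n))) (hΩ : IsSmoothBoundedDomain Ω)
    (hconv : Convex ℝ Ω) :
    ∃ ρ γ : ℝ, 0 < ρ ∧ 0 < γ ∧
      ∀ f : ℝ → ℝ, LocallyLipschitz f →
      ∀ u : EuclideanSpace ℝ (Fin n) → ℝ,
        IsClassicalSol Ω f u → (∀ x ∈ Ω, 0 < u x) →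
        (∀ x ∈ Ω, Metric.infDist x (frontier Ω) < ρ →
          ∃ I : Set (EuclideanSpace ℝ (Fin n)), I ⊆ Ω ∧ MeasurableSet I ∧
            γ ≤ (volume I).toReal ∧ ∀ y ∈ I, u x ≤ u y) ∧
        (∀ x ∈ Ω, Metric.infDist x (frontier Ω) < ρ →
          u x ≤ (1 / γ) * ∫ y in Ω, u y) := by
  obtain ⟨ρ, r, hρ, hr, h⟩ := exists_ball_subset_le (by omega) hΩ hconv
  have hγ : 0 < (volume (Metric.ball (0 : EuclideanSpace ℝ (Fin n)) r)).toReal :=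
    ENNReal.toReal_pos (Metric.measure_ball_pos _ _ hr).ne' measure_ball_lt_top.ne
  refine ⟨ρ, _, hρ, hγ, fun f hf u hu hpos => ⟨fun x hx hdist => ?_, fun x hx hdist => ?_⟩⟩ <;>
    obtain ⟨c, hcΩ, hc⟩ := h f hf u hu hpos x hx hdist
  · exact ⟨_, hcΩ, measurableSet_ball, by rw [Measure.addHaar_ball_center volume c], hc⟩
  · obtain ⟨⟨U, -, hΩU, huU⟩, -, -⟩ := hu
    have hint : IntegrableOn u Ω volume :=
      ((huU.continuousOn.mono hΩU).integrableOn_compact hΩ.2.1.isCompact_closure).mono_set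
        subset_closure
    rw [one_div, ← div_eq_inv_mul, le_div_iff₀ hγ]
    calc u x * (volume (Metric.ball (0 : EuclideanSpace ℝ (Fin n)) r)).toReal
        = ∫ _ in Metric.ball c r, u x := by
          rw [setIntegral_const, measureReal_def, Measure.addHaar_ball_center volume c,
            smul_eq_mul, mul_comm]
      _ ≤ ∫ y in Metric.ball c r, u y :=
          setIntegral_mono_on (integrableOn_const measure_ball_lt_top.ne) (hint.mono_set hcΩ)
            measurableSet_ball hc
      _ ≤ ∫ y in Ω, u y :=
          setIntegral_mono_set hint
            (ae_restrict_of_forall_mem hΩ.1.measurableSet fun y hy => (hpos y hy).le)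
            (Eventually.of_forall hcΩ)
end
end

section
/- (Boundary estimate in the plane without convexity.) Let Ω ⊆ ℝ² be a bounded smooth domain (not necessarily convex). Then there exist positive constants ρ and γ, depending only on Ω, such that for every locally Lipschitz function f : ℝ → ℝ with f ≥ 0 on [0,∞) and every positive classical solution u of −Δu = f(u) in Ω with u = 0 on ∂Ω, one has sup_{x ∈ Ω_ρ} u(x) ≤ (1/γ) ∫_Ω u(y) dy, where Ω_ρ = {x ∈ Ω : dist(x,∂Ω) < ρ}. -/
open MeasureTheory Filter

noncomputable section

/-- The Euclidean plane. -/
abbrev Plane := EuclideanSpace ℝ (Fin 2)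

/-- The standard basis vectors of the plane. -/
abbrev basisVec (i : Fin 2) : Plane := EuclideanSpace.single i 1

open Topology EuclideanGeometry

/-! ### The Laplacian -/

lemma ContDiffAt.differentiableAt_fderiv_apply {F : Type*} [NormedAddCommGroup F]
    [NormedSpace ℝ F] {g : Plane → F} {x : Plane} (hg : ContDiffAt ℝ 2 g x) (e : Plane) :
    DifferentiableAt ℝ (fun y => fderiv ℝ g y e) x :=
  ((hg.fderiv_right (m := 1) (by norm_num)).differentiableAt (by norm_num)).clm_apply
    (differentiableAt_const e)

lemma ContDiffAt.eventually_differentiableAt {F : Type*} [NormedAddCommGroup F]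
    [NormedSpace ℝ F] {g : Plane → F} {x : Plane} (hg : ContDiffAt ℝ 2 g x) :
    ∀ᶠ y in 𝓝 x, DifferentiableAt ℝ g y :=
  (hg.eventually (by simp)).mono fun _ hy => hy.differentiableAt (by norm_num)

lemma lapl_sub_const_mul {g h : Plane → ℝ} {x : Plane} (hg : ContDiffAt ℝ 2 g x)
    (hh : ContDiffAt ℝ 2 h x) (m : ℝ) :
    lapl (fun y => g y - m * h y) x = lapl g x - m * lapl h x := by
  unfold lapl
  rw [Finset.mul_sum, ← Finset.sum_sub_distrib]
  refine Finset.sum_congr rfl fun i _ => ?_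
  have key : (fun y => fderiv ℝ (fun z => g z - m * h z) y (basisVec i)) =ᶠ[𝓝 x]
      fun y => fderiv ℝ g y (basisVec i) - m * fderiv ℝ h y (basisVec i) := by
    filter_upwards [hg.eventually_differentiableAt, hh.eventually_differentiableAt] with y h1 h2
    rw [((h1.hasFDerivAt).fun_sub ((h2.hasFDerivAt).const_mul m)).fderiv]
    simp
  rw [key.fderiv_eq, (((hg.differentiableAt_fderiv_apply _).hasFDerivAt).fun_sub
    (((hh.differentiableAt_fderiv_apply _).hasFDerivAt).const_mul m)).fderiv]
  simp

lemma nonneg_of_isLocalMin_of_deriv_deriv {φ : ℝ → ℝ} {t : ℝ} (hφ : IsLocalMin φ t)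
    (hc : ContinuousAt φ t) : 0 ≤ deriv (deriv φ) t := by
  by_contra! hneg
  have hmax := isLocalMax_of_deriv_deriv_neg hneg hφ.deriv_eq_zero hc
  have hconst : φ =ᶠ[𝓝 t] fun _ => φ t := by
    filter_upwards [hφ, hmax] with s h1 h2 using le_antisymm h2 h1
  have := hconst.deriv.deriv_eq
  simp at this
  linarith

lemma IsLocalMin.lapl_nonneg {g : Plane → ℝ} {x : Plane} (hmin : IsLocalMin g x)
    (hg : ContDiffAt ℝ 2 g x) : 0 ≤ lapl g x := by
  refine Finset.sum_nonneg fun i _ => ?_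
  set e := basisVec i
  have hline : ∀ t : ℝ, HasDerivAt (fun t : ℝ => x + t • e) e t := fun t => by
    simpa using ((hasDerivAt_id t).smul_const e).const_add x
  have hcont : Tendsto (fun t : ℝ => x + t • e) (𝓝 0) (𝓝 x) := by
    have := (hline 0).continuousAt.tendsto
    simpa using this
  have hd : deriv (fun t : ℝ => g (x + t • e)) =ᶠ[𝓝 0]
      fun t => fderiv ℝ g (x + t • e) e := by
    filter_upwards [hcont.eventually hg.eventually_differentiableAt] with t ht
    exact (ht.hasFDerivAt.comp_hasDerivAt t (hline t)).deriv
  have hdd : deriv (deriv (fun t : ℝ => g (x + t • e))) 0 =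
      fderiv ℝ (fun y => fderiv ℝ g y e) x e := by
    rw [hd.deriv_eq]
    have h2 := (hg.differentiableAt_fderiv_apply e).hasFDerivAt
    have hx : x = x + (0 : ℝ) • e := by simp
    rw [hx] at h2
    have h3 := (h2.comp_hasDerivAt (0 : ℝ) (hline 0)).deriv
    rw [← hx] at h3
    exact h3
  rw [← hdd]
  have hx0 : g (x + (0 : ℝ) • e) = g x := by simp
  refine nonneg_of_isLocalMin_of_deriv_deriv ?_ ?_
  · filter_upwards [hcont.eventually hmin] with t ht
    rw [hx0]; exact ht
  · have : ContinuousAt g (x + (0 : ℝ) • e) := by simpa using hg.continuousAt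
    exact ContinuousAt.comp (f := fun t : ℝ => x + t • e) this (hline 0).continuousAt

lemma hasFDerivAt_coord_sub (c x : Plane) (i : Fin 2) :
    HasFDerivAt (fun y : Plane => y i - c i) (EuclideanSpace.proj i : Plane →L[ℝ] ℝ) x :=
  (EuclideanSpace.proj i : Plane →L[ℝ] ℝ).hasFDerivAt.sub_const (c i)

lemma plane_norm_sq (y : Plane) : ‖y‖ ^ 2 = y 0 ^ 2 + y 1 ^ 2 := by
  simp [EuclideanSpace.norm_sq_eq]

lemma hasFDerivAt_norm_sub_sq (c x : Plane) :
    HasFDerivAt (fun y : Plane => ‖y - c‖ ^ 2)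
      ((2 * (x 0 - c 0)) • (EuclideanSpace.proj 0 : Plane →L[ℝ] ℝ) +
        (2 * (x 1 - c 1)) • (EuclideanSpace.proj 1 : Plane →L[ℝ] ℝ)) x := by
  have h := ((hasFDerivAt_coord_sub c x 0).pow 2).add ((hasFDerivAt_coord_sub c x 1).pow 2)
  have e : (fun y : Plane => ‖y - c‖ ^ 2) = fun y => (y 0 - c 0) ^ 2 + (y 1 - c 1) ^ 2 := by
    ext y; simp [plane_norm_sq]
  rw [e]
  refine h.congr_fderiv ?_
  simp

lemma lapl_radial {φ φ' : ℝ → ℝ} {φ'' : ℝ} {c x : Plane}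
    (h1 : ∀ t, HasDerivAt φ (φ' t) t) (h2 : HasDerivAt φ' φ'' (‖x - c‖ ^ 2)) :
    lapl (fun y => φ (‖y - c‖ ^ 2)) x =
      4 * ‖x - c‖ ^ 2 * φ'' + 4 * φ' (‖x - c‖ ^ 2) := by
  have key : ∀ i : Fin 2, (fun y => fderiv ℝ (fun z : Plane => φ (‖z - c‖ ^ 2)) y (basisVec i))
      = fun y => φ' (‖y - c‖ ^ 2) * (2 * (y i - c i)) := by
    intro i
    ext y
    have h : HasFDerivAt (fun z : Plane => φ (‖z - c‖ ^ 2)) _ y :=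
      (h1 (‖y - c‖ ^ 2)).comp_hasFDerivAt y (hasFDerivAt_norm_sub_sq c y)
    rw [h.fderiv]
    fin_cases i <;> simp
  have key2 : ∀ i : Fin 2, fderiv ℝ (fun y => φ' (‖y - c‖ ^ 2) * (2 * (y i - c i))) x
      (basisVec i) = 4 * φ'' * (x i - c i) ^ 2 + 2 * φ' (‖x - c‖ ^ 2) := by
    intro i
    have h : HasFDerivAt (fun z : Plane => φ' (‖z - c‖ ^ 2)) _ x :=
      h2.comp_hasFDerivAt x (hasFDerivAt_norm_sub_sq c x)
    rw [(h.fun_mul ((hasFDerivAt_coord_sub c x i).const_mul 2)).fderiv]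
    fin_cases i <;> simp <;> ring
  unfold lapl
  simp only [key, key2, Fin.sum_univ_two]
  rw [plane_norm_sq (x - c)]
  simp
  ring

lemma lapl_comp {u : Plane → ℝ} {Φ : Plane → Plane} {x : Plane}
    (hΦ : ContDiffAt ℝ 2 Φ x) (hu : ContDiffAt ℝ 2 u (Φ x)) :
    lapl (fun y => u (Φ y)) x =
      ∑ i : Fin 2, (fderiv ℝ (fderiv ℝ u) (Φ x) (fderiv ℝ Φ x (basisVec i))
          (fderiv ℝ Φ x (basisVec i)) +
        fderiv ℝ u (Φ x) (fderiv ℝ (fun y => fderiv ℝ Φ y (basisVec i)) x (basisVec i))) := by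
  refine Finset.sum_congr rfl fun i _ => ?_
  have key : (fun y => fderiv ℝ (fun z => u (Φ z)) y (basisVec i)) =ᶠ[𝓝 x]
      fun y => fderiv ℝ u (Φ y) (fderiv ℝ Φ y (basisVec i)) := by
    filter_upwards [hΦ.eventually_differentiableAt,
      hΦ.continuousAt.eventually hu.eventually_differentiableAt] with y h1 h2
    have h : HasFDerivAt (fun z => u (Φ z)) _ y := h2.hasFDerivAt.comp y h1.hasFDerivAt
    rw [h.fderiv]
    rfl
  have hDu : HasFDerivAt (fun y => fderiv ℝ u (Φ y))
      ((fderiv ℝ (fderiv ℝ u) (Φ x)).comp (fderiv ℝ Φ x)) x :=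
    (((hu.fderiv_right (m := 1) (by norm_num)).differentiableAt
      (by norm_num)).hasFDerivAt).comp x (hΦ.differentiableAt (by norm_num)).hasFDerivAt
  rw [key.fderiv_eq,
    (hDu.clm_apply (hΦ.differentiableAt_fderiv_apply (basisVec i)).hasFDerivAt).fderiv]
  simp [add_comm]

lemma lapl_eq_hessian {u : Plane → ℝ} {x : Plane} (hu : ContDiffAt ℝ 2 u x) :
    lapl u x = ∑ i : Fin 2, fderiv ℝ (fderiv ℝ u) x (basisVec i) (basisVec i) := by
  refine Finset.sum_congr rfl fun i _ => ?_
  have hDu := ((hu.fderiv_right (m := 1) (by norm_num)).differentiableAt (by norm_num)).hasFDerivAt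
  rw [(hDu.clm_apply (hasFDerivAt_const (basisVec i) x)).fderiv]
  simp

/-- The Laplacian is multiplied by the conformal factor under composition with a conformal map
with harmonic components. -/
lemma lapl_comp_of_conformal {u : Plane → ℝ} {Φ : Plane → Plane} {x : Plane} {a b : ℝ}
    (hΦ : ContDiffAt ℝ 2 Φ x) (hu : ContDiffAt ℝ 2 u (Φ x))
    (h0 : fderiv ℝ Φ x (basisVec 0) = a • basisVec 0 + b • basisVec 1)
    (h1 : fderiv ℝ Φ x (basisVec 1) = b • basisVec 0 - a • basisVec 1)
    (hharm : ∑ i : Fin 2, fderiv ℝ (fun y => fderiv ℝ Φ y (basisVec i)) x (basisVec i) = 0) :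
    lapl (fun y => u (Φ y)) x = (a ^ 2 + b ^ 2) * lapl u (Φ x) := by
  rw [lapl_comp hΦ hu, Finset.sum_add_distrib, ← map_sum, hharm, lapl_eq_hessian hu]
  simp only [Fin.sum_univ_two, h0, h1, map_add, map_sub, map_smul, map_zero,
    add_apply, sub_apply, smul_apply, smul_eq_mul]
  ring

lemma inversion_eq (c : Plane) (l : ℝ) (y : Plane) :
    inversion c l y = c + (l ^ 2 / ‖y - c‖ ^ 2) • (y - c) := by
  rw [inversion, dist_eq_norm, div_pow]
  simp [add_comm]

lemma contDiffAt_inversion {c x : Plane} (l : ℝ) (hx : x ≠ c) :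
    ContDiffAt ℝ 2 (inversion c l) x :=
  contDiffAt_const.inversion contDiffAt_const contDiffAt_id hx

lemma inversion_apply (c : Plane) (l : ℝ) (y : Plane) (j : Fin 2) :
    inversion c l y j = c j + l ^ 2 * (y j - c j) / ((y 0 - c 0) ^ 2 + (y 1 - c 1) ^ 2) := by
  rw [inversion_eq, plane_norm_sq]
  simp
  ring

lemma coord_sq_ne_zero {c y : Plane} (hy : y ≠ c) :
    (y 0 - c 0) ^ 2 + (y 1 - c 1) ^ 2 ≠ 0 := by
  have := plane_norm_sq (y - c)
  simp only [PiLp.sub_apply] at this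
  rw [← this]
  exact pow_ne_zero 2 (norm_ne_zero_iff.2 (sub_ne_zero.2 hy))

lemma hasFDerivAt_coord_sq (c x : Plane) :
    HasFDerivAt (fun y : Plane => (y 0 - c 0) ^ 2 + (y 1 - c 1) ^ 2)
      ((2 * (x 0 - c 0)) • (EuclideanSpace.proj 0 : Plane →L[ℝ] ℝ) +
        (2 * (x 1 - c 1)) • (EuclideanSpace.proj 1 : Plane →L[ℝ] ℝ)) x := by
  have h := hasFDerivAt_norm_sub_sq c x
  simpa only [plane_norm_sq, PiLp.sub_apply] using h

lemma fderiv_apply_coord {Φ : Plane → Plane} {x : Plane} (hΦ : DifferentiableAt ℝ Φ x)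
    (v : Plane) (j : Fin 2) : fderiv ℝ Φ x v j = fderiv ℝ (fun y => Φ y j) x v := by
  have h : HasFDerivAt (fun y => Φ y j) _ x :=
    (EuclideanSpace.proj j : Plane →L[ℝ] ℝ).hasFDerivAt.comp x hΦ.hasFDerivAt
  rw [h.fderiv]
  simp

lemma hasFDerivAt_div {f g : Plane → ℝ} {f' g' : Plane →L[ℝ] ℝ} {x : Plane}
    (hf : HasFDerivAt f f' x) (hg : HasFDerivAt g g' x) (h : g x ≠ 0) :
    HasFDerivAt (fun y => f y / g y) ((g x)⁻¹ • f' - (f x / g x ^ 2) • g') x := by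
  have hinv : HasFDerivAt (fun y => (g y)⁻¹) _ x := (hasDerivAt_inv h).comp_hasFDerivAt x hg
  simp only [div_eq_mul_inv]
  refine (hf.fun_mul hinv).congr_fderiv ?_
  ext v
  simp
  ring

lemma fderiv_inversion_apply {c x : Plane} (l : ℝ) (hx : x ≠ c) (i j : Fin 2) :
    fderiv ℝ (inversion c l) x (basisVec i) j =
      l ^ 2 * ((if i = j then 1 else 0) * ((x 0 - c 0) ^ 2 + (x 1 - c 1) ^ 2)
        - 2 * (x j - c j) * (x i - c i)) / ((x 0 - c 0) ^ 2 + (x 1 - c 1) ^ 2) ^ 2 := by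
  rw [fderiv_apply_coord ((contDiffAt_inversion l hx).differentiableAt (by norm_num))]
  have hN := coord_sq_ne_zero hx
  simp only [inversion_apply]
  rw [((hasFDerivAt_div ((hasFDerivAt_coord_sub c x j).const_mul (l ^ 2))
    (hasFDerivAt_coord_sq c x) hN).const_add (c j)).fderiv]
  fin_cases i <;> fin_cases j <;> simp <;> field_simp

lemma sum_fderiv_fderiv_inversion {c x : Plane} (l : ℝ) (hx : x ≠ c) :
    ∑ i : Fin 2, fderiv ℝ (fun y => fderiv ℝ (inversion c l) y (basisVec i)) x
      (basisVec i) = 0 := by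
  have hN := coord_sq_ne_zero hx
  have key : ∀ i j : Fin 2,
      fderiv ℝ (fun y => fderiv ℝ (inversion c l) y (basisVec i)) x (basisVec i) j =
      fderiv ℝ (fun y : Plane => l ^ 2 * ((if i = j then 1 else 0) *
        ((y 0 - c 0) ^ 2 + (y 1 - c 1) ^ 2) - 2 * (y j - c j) * (y i - c i)) /
          ((y 0 - c 0) ^ 2 + (y 1 - c 1) ^ 2) ^ 2) x (basisVec i) := by
    intro i j
    rw [fderiv_apply_coord ((contDiffAt_inversion l hx).differentiableAt_fderiv_apply _)]
    refine congrArg (fun L : Plane →L[ℝ] ℝ => L (basisVec i)) (Filter.EventuallyEq.fderiv_eq ?_)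
    filter_upwards [isOpen_ne.mem_nhds hx] with y hy
    exact fderiv_inversion_apply l hy i j
  have key2 : ∀ i j : Fin 2, HasFDerivAt (fun y : Plane => l ^ 2 * ((if i = j then 1 else 0) *
        ((y 0 - c 0) ^ 2 + (y 1 - c 1) ^ 2) - 2 * (y j - c j) * (y i - c i)) /
          ((y 0 - c 0) ^ 2 + (y 1 - c 1) ^ 2) ^ 2) _ x := fun i j =>
    hasFDerivAt_div ((((hasFDerivAt_coord_sq c x).const_mul (if i = j then 1 else 0)).fun_sub
      (((hasFDerivAt_coord_sub c x j).const_mul 2).fun_mul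
        (hasFDerivAt_coord_sub c x i))).const_mul (l ^ 2))
      ((hasFDerivAt_coord_sq c x).pow 2) (pow_ne_zero 2 hN)
  ext j
  simp only [Fin.sum_univ_two, PiLp.add_apply, key, (key2 _ _).fderiv]
  fin_cases j <;> simp <;> field_simp <;> ring

lemma plane_ext_basis (v : Plane) (p q : ℝ) (h0 : v 0 = p) (h1 : v 1 = q) :
    v = p • basisVec 0 + q • basisVec 1 := by
  ext j
  fin_cases j <;> simp [h0, h1]

lemma lapl_comp_inversion {u : Plane → ℝ} {c x : Plane} (l : ℝ) (hx : x ≠ c)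
    (hu : ContDiffAt ℝ 2 u (inversion c l x)) :
    lapl (fun y => u (inversion c l y)) x =
      (l / ‖x - c‖) ^ 4 * lapl u (inversion c l x) := by
  have hN := coord_sq_ne_zero hx
  set N := (x 0 - c 0) ^ 2 + (x 1 - c 1) ^ 2 with hNdef
  have hn : ‖x - c‖ ^ 2 = N := by rw [plane_norm_sq]; simp [hNdef]
  rw [lapl_comp_of_conformal (a := l ^ 2 * (N - 2 * (x 0 - c 0) * (x 0 - c 0)) / N ^ 2)
    (b := l ^ 2 * (- 2 * (x 0 - c 0) * (x 1 - c 1)) / N ^ 2)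
    (contDiffAt_inversion l hx) hu ?_ ?_ (sum_fderiv_fderiv_inversion l hx)]
  · congr 1
    rw [div_pow l, show ‖x - c‖ ^ 4 = N ^ 2 by rw [← hn]; ring]
    field_simp
    rw [hNdef]
    ring
  · refine plane_ext_basis _ _ _ ?_ ?_ <;> rw [fderiv_inversion_apply l hx, ← hNdef]
    · simp
    · simp; ring
  · rw [sub_eq_add_neg, ← neg_smul]
    refine plane_ext_basis _ _ _ ?_ ?_ <;> rw [fderiv_inversion_apply l hx, ← hNdef]
    · simp
    · simp; field_simp; rw [hNdef]; ring

/-! ### Maximum principles -/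

lemma nonneg_of_narrow {K : Set Plane} (hK : IsCompact K) {w : Plane → ℝ}
    (hwc : ContinuousOn w K) {c : Plane} {τ A κ C : ℝ} (hC : 0 ≤ C) (hA : 0 ≤ A)
    (hκτ : κ ≤ τ / 4) (hAκ : A * κ ^ 2 ≤ 1) (hAC : 2 * C < 4 * A * τ)
    (hnarrow : ∀ y ∈ K, |‖y - c‖ ^ 2 - τ| ≤ κ)
    (hw : ∀ y ∈ K, w y < 0 → K ∈ 𝓝 y ∧ ContDiffAt ℝ 2 w y ∧ lapl w y ≤ -(C * w y)) :
    ∀ y ∈ K, 0 ≤ w y := by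
  set h : Plane → ℝ := fun y => 2 - A * (‖y - c‖ ^ 2 - τ) ^ 2 with hh
  have hsmooth : ContDiff ℝ 2 h := by
    have : ContDiff ℝ 2 fun y : Plane => ‖y - c‖ ^ 2 := (contDiff_id.sub contDiff_const).norm_sq ℝ
    fun_prop
  have hsq : ∀ y ∈ K, A * (‖y - c‖ ^ 2 - τ) ^ 2 ≤ 1 := fun y hy => by
    refine le_trans (mul_le_mul_of_nonneg_left ?_ hA) hAκ
    exact sq_le_sq' (by linarith [neg_le_of_abs_le (hnarrow y hy)]) (le_of_abs_le (hnarrow y hy))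
  have hone : ∀ y ∈ K, 1 ≤ h y := fun y hy => by simp only [hh]; linarith [hsq y hy]
  have hlap : ∀ y ∈ K, lapl h y + C * h y < 0 := fun y hy => by
    have hd1 : ∀ t : ℝ, HasDerivAt (fun t => 2 - A * (t - τ) ^ 2) (-2 * A * (t - τ)) t := by
      intro t
      have := ((((hasDerivAt_id t).sub_const τ).pow 2).const_mul A).const_sub 2
      refine this.congr_deriv ?_
      simp; ring
    have hd2 : HasDerivAt (fun t : ℝ => -2 * A * (t - τ)) (-2 * A) (‖y - c‖ ^ 2) := by
      simpa using ((hasDerivAt_id (‖y - c‖ ^ 2)).sub_const τ).const_mul (-2 * A)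
    have hl : lapl h y = _ := lapl_radial hd1 hd2
    have h2 : h y ≤ 2 := by
      have : 0 ≤ A * (‖y - c‖ ^ 2 - τ) ^ 2 := by positivity
      simp only [hh]; linarith
    have h3 := neg_le_of_abs_le (hnarrow y hy)
    rw [hl]
    nlinarith [mul_nonneg hA (by linarith : 0 ≤ ‖y - c‖ ^ 2 - τ + τ / 4),
      mul_le_mul_of_nonneg_left h2 hC]
  by_contra! hneg
  obtain ⟨y₁, hy₁, hwy₁⟩ := hneg
  obtain ⟨y₀, hy₀, hmin⟩ := hK.exists_isMinOn ⟨y₁, hy₁⟩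
    (hwc.div hsmooth.continuous.continuousOn fun y hy => (by linarith [hone y hy] : h y ≠ 0) )
  have hpos : ∀ y ∈ K, 0 < h y := fun y hy => by linarith [hone y hy]
  set m := w y₀ / h y₀ with hm
  have hmneg : m < 0 := lt_of_le_of_lt (hmin hy₁) (div_neg_of_neg_of_pos hwy₁ (hpos _ hy₁))
  have hwm : w y₀ = m * h y₀ := by rw [hm, div_mul_cancel₀ _ (hpos _ hy₀).ne']
  have hwy₀ : w y₀ < 0 := by rw [hwm]; exact mul_neg_of_neg_of_pos hmneg (hpos _ hy₀)
  obtain ⟨hKn, hwd, hwl⟩ := hw y₀ hy₀ hwy₀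
  have hloc : IsLocalMin (fun y => w y - m * h y) y₀ := by
    filter_upwards [hKn] with y hy
    have : m ≤ w y / h y := hmin hy
    rw [le_div_iff₀ (hpos y hy)] at this
    rw [hwm]; linarith
  have := hloc.lapl_nonneg (hwd.sub (contDiffAt_const.mul hsmooth.contDiffAt))
  rw [lapl_sub_const_mul hwd hsmooth.contDiffAt] at this
  have h4 := hlap y₀ hy₀
  rw [hwm] at hwl
  nlinarith

lemma pos_of_superharmonic {w : Plane → ℝ} {p : Plane} {R C : ℝ} (hC : 0 ≤ C)
    (hw : ∀ y ∈ Metric.closedBall p R, ContDiffAt ℝ 2 w y)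
    (hnonneg : ∀ y ∈ Metric.closedBall p R, 0 ≤ w y)
    (hlap : ∀ y ∈ Metric.closedBall p R, lapl w y ≤ C * w y) (hp : 0 < w p) :
    ∀ y ∈ Metric.ball p R, 0 < w y := by
  intro q hq
  have hR : 0 < R := dist_nonneg.trans_lt hq
  have hpR : p ∈ Metric.closedBall p R := Metric.mem_closedBall_self hR.le
  obtain ⟨r, hr, hrpos⟩ : ∃ r > 0, ∀ y ∈ Metric.ball p r, w p / 2 < w y :=
    Metric.eventually_nhds_iff_ball.1
      ((hw p hpR).continuousAt.eventually (lt_mem_nhds (half_lt_self hp)))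
  set α := (C + 2) / r ^ 2 + 1 with hα
  have hαpos : 0 < α := by positivity
  have hαr : C + 2 ≤ α * r ^ 2 := by
    rw [hα, add_mul, div_mul_cancel₀ _ (by positivity)]
    nlinarith [sq_nonneg r]
  set v : Plane → ℝ := fun y => Real.exp (-α * ‖y - p‖ ^ 2) - Real.exp (-α * R ^ 2) with hv
  have hvsmooth : ContDiff ℝ 2 v := by
    have : ContDiff ℝ 2 fun y : Plane => ‖y - p‖ ^ 2 := (contDiff_id.sub contDiff_const).norm_sq ℝ
    exact (contDiff_const.mul this).exp.sub contDiff_const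
  have hvlap : ∀ y, r ≤ ‖y - p‖ → C * v y < lapl v y := fun y hy => by
    have hd : ∀ t : ℝ, HasDerivAt (fun t => Real.exp (-α * t)) (-α * Real.exp (-α * t)) t := by
      intro t
      have := ((hasDerivAt_id t).const_mul (-α)).exp
      refine this.congr_deriv ?_
      simp; ring
    have hl : lapl v y = _ := lapl_radial
      (φ := fun t => Real.exp (-α * t) - Real.exp (-α * R ^ 2)) (fun t => (hd t).sub_const _)
      ((hd _).const_mul (-α))
    have hry : r ^ 2 ≤ ‖y - p‖ ^ 2 := pow_le_pow_left₀ hr.le hy 2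
    have hαy : C + 2 ≤ α * ‖y - p‖ ^ 2 := hαr.trans (mul_le_mul_of_nonneg_left hry hαpos.le)
    have hE := Real.exp_pos (-α * ‖y - p‖ ^ 2)
    have hα1 : 1 ≤ α := by
      have : 0 ≤ (C + 2) / r ^ 2 := by positivity
      linarith
    have h1 : C < 4 * α * (α * ‖y - p‖ ^ 2 - 1) := by nlinarith
    have h2 : C * v y ≤ C * Real.exp (-α * ‖y - p‖ ^ 2) :=
      mul_le_mul_of_nonneg_left (by simp only [hv]; linarith [Real.exp_pos (-α * R ^ 2)]) hC
    rw [hl]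
    nlinarith [mul_lt_mul_of_pos_right h1 hE]
  have hvle : ∀ y, v y ≤ 1 := fun y => by
    have : Real.exp (-α * ‖y - p‖ ^ 2) ≤ 1 := Real.exp_le_one_iff.2 (by
      nlinarith [sq_nonneg ‖y - p‖])
    simp only [hv]; linarith [Real.exp_pos (-α * R ^ 2)]
  set ε := w p / 2 with hε
  have hεpos : 0 < ε := half_pos hp
  have hcomp : ∀ y ∈ Metric.closedBall p R, 0 ≤ w y - ε * v y := by
    obtain ⟨y₀, hy₀, hmin⟩ := (isCompact_closedBall p R).exists_isMinOn ⟨p, hpR⟩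
      (f := fun y => w y - ε * v y) (ContinuousOn.sub
        (fun y hy => (hw y hy).continuousAt.continuousWithinAt)
        (continuousOn_const.mul hvsmooth.continuous.continuousOn))
    refine fun y hy => le_trans ?_ (hmin hy)
    by_contra! hneg
    have hnball : ¬ y₀ ∈ Metric.ball p r := fun hb => by
      have h1 := hrpos y₀ hb
      have := hvle y₀
      nlinarith
    have hny : r ≤ ‖y₀ - p‖ := by simpa [dist_eq_norm] using hnball
    have hlt : y₀ ∈ Metric.ball p R := by
      by_contra hR'
      have hle : R ≤ ‖y₀ - p‖ := by simpa [dist_eq_norm] using hR'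
      have : v y₀ ≤ 0 := by
        have hR2 : R ^ 2 ≤ ‖y₀ - p‖ ^ 2 := pow_le_pow_left₀ hR.le hle 2
        have : Real.exp (-α * ‖y₀ - p‖ ^ 2) ≤ Real.exp (-α * R ^ 2) :=
          Real.exp_le_exp.2 (by nlinarith)
        simp only [hv]; linarith
      have := hnonneg y₀ hy₀
      nlinarith
    have hloc : IsLocalMin (fun y => w y - ε * v y) y₀ :=
      hmin.isLocalMin (Filter.mem_of_superset (Metric.isOpen_ball.mem_nhds hlt)
        Metric.ball_subset_closedBall)
    have h1 := hloc.lapl_nonneg ((hw y₀ hy₀).sub (contDiffAt_const.mul hvsmooth.contDiffAt))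
    rw [lapl_sub_const_mul (hw y₀ hy₀) hvsmooth.contDiffAt] at h1
    have h2 := hvlap y₀ hny
    have h3 := hlap y₀ hy₀
    nlinarith [mul_lt_mul_of_pos_left h2 hεpos]
  have hvq : 0 < v q := by
    have hqR : ‖q - p‖ < R := by simpa [dist_eq_norm] using hq
    have hlt : ‖q - p‖ ^ 2 < R ^ 2 := pow_lt_pow_left₀ hqR (norm_nonneg _) two_ne_zero
    have : Real.exp (-α * R ^ 2) < Real.exp (-α * ‖q - p‖ ^ 2) :=
      Real.exp_lt_exp.2 (by nlinarith)
    simp only [hv]; linarith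
  have := hcomp q (Metric.ball_subset_closedBall hq)
  nlinarith

/-! ### The method of moving circles -/

lemma lapl_reflection_sub_le {u : Plane → ℝ} {f : ℝ → ℝ} {Ω : Set Plane} {c y : Plane} {l C : ℝ}
    (hyΩ : y ∈ Ω) (hyc : y ≠ c) (hl : ‖y - c‖ ≤ l) (hiΩ : inversion c l y ∈ Ω)
    (huy : ContDiffAt ℝ 2 u y) (hui : ContDiffAt ℝ 2 u (inversion c l y))
    (heq : ∀ x ∈ Ω, lapl u x + f (u x) = 0) (hf : 0 ≤ f (u (inversion c l y)))
    (hLip : |f (u y) - f (u (inversion c l y))| ≤ C * |u y - u (inversion c l y)|) :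
    lapl (fun z => u (inversion c l z) - u z) y ≤ C * |u (inversion c l y) - u y| := by
  have hcomp : ContDiffAt ℝ 2 (fun z => u (inversion c l z)) y :=
    hui.comp y (contDiffAt_inversion l hyc)
  have h := lapl_sub_const_mul hcomp huy 1
  simp only [one_mul] at h
  rw [h, lapl_comp_inversion l hyc hui, eq_neg_of_add_eq_zero_left (heq y hyΩ),
    eq_neg_of_add_eq_zero_left (heq _ hiΩ), abs_sub_comm (u (inversion c l y))]
  have hn : 0 < ‖y - c‖ := norm_pos_iff.2 (sub_ne_zero.2 hyc)
  have hfac : 1 ≤ (l / ‖y - c‖) ^ 4 := one_le_pow₀ ((one_le_div hn).2 hl)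
  have := le_of_abs_le hLip
  nlinarith

lemma contDiffAt_reflection_sub {u : Plane → ℝ} {c y : Plane} {l : ℝ} (hyc : y ≠ c)
    (huy : ContDiffAt ℝ 2 u y) (hui : ContDiffAt ℝ 2 u (inversion c l y)) :
    ContDiffAt ℝ 2 (fun z => u (inversion c l z) - u z) y :=
  ContDiffAt.sub (hui.comp y (contDiffAt_inversion l hyc)) huy

lemma LocallyLipschitz.exists_abs_sub_le_on_image {u : Plane → ℝ} {f : ℝ → ℝ} {K : Set Plane}
    (hf : LocallyLipschitz f) (hK : IsCompact K) (hu : ContinuousOn u K) :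
    ∃ C : ℝ, 0 ≤ C ∧ ∀ x ∈ K, ∀ y ∈ K, |f (u x) - f (u y)| ≤ C * |u x - u y| := by
  obtain ⟨C, hC⟩ := (hf.locallyLipschitzOn (s := u '' K)).exists_lipschitzOnWith_of_compact
    (hK.image_of_continuousOn hu)
  refine ⟨C, C.2, fun x hx y hy => ?_⟩
  have := hC.dist_le_mul _ (Set.mem_image_of_mem u hx) _ (Set.mem_image_of_mem u hy)
  simpa [Real.dist_eq] using this

/-- Strict form of the comparison between `u` and its reflection across a circle. -/
lemma lt_reflection_of_le_reflection {Ω : Set Plane} {f : ℝ → ℝ} {u : Plane → ℝ} {c : Plane}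
    {l : ℝ} (hΩo : IsOpen Ω) (hΩb : Bornology.IsBounded Ω)
    (hu : ∀ x ∈ closure Ω, ContDiffAt ℝ 2 u x)
    (hf : LocallyLipschitz f) (hf0 : ∀ s : ℝ, 0 ≤ s → 0 ≤ f s)
    (heq : ∀ x ∈ Ω, lapl u x + f (u x) = 0) (hfr : ∀ x ∈ frontier Ω, u x = 0)
    (hpos : ∀ x ∈ Ω, 0 < u x) (hc : c ∉ closure Ω)
    (hrefl : ∀ y ∈ closure Ω, ‖y - c‖ < l → inversion c l y ∈ Ω)
    (hle : ∀ y ∈ closure Ω, ‖y - c‖ ≤ l → u y ≤ u (inversion c l y)) :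
    ∀ y ∈ closure Ω, ‖y - c‖ < l → u y < u (inversion c l y) := by
  intro y hy hyl
  by_contra! hcon
  have hcpt : IsCompact (closure Ω) := hΩb.isCompact_closure
  have hucont : ContinuousOn u (closure Ω) := fun x hx => (hu x hx).continuousAt.continuousWithinAt
  obtain ⟨C, hC, hLip⟩ := hf.exists_abs_sub_le_on_image hcpt hucont
  have hne : ∀ z ∈ closure Ω, z ≠ c := fun z hz h => hc (h ▸ hz)
  set w : Plane → ℝ := fun z => u (inversion c l z) - u z with hw
  have hwd : ∀ z ∈ closure Ω, ‖z - c‖ < l → ContDiffAt ℝ 2 w z := fun z hz hzl =>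
    contDiffAt_reflection_sub (hne z hz) (hu z hz) (hu _ (subset_closure (hrefl z hz hzl)))
  set K := closure Ω ∩ Metric.closedBall c ‖y - c‖ with hK
  have hKl : ∀ z ∈ K, ‖z - c‖ < l := fun z hz =>
    lt_of_le_of_lt (by simpa [dist_eq_norm] using hz.2) hyl
  have hKcpt : IsCompact K := hcpt.inter_right Metric.isClosed_closedBall
  have hwK : ContinuousOn w K := fun z hz =>
    (hwd z hz.1 (hKl z hz)).continuousAt.continuousWithinAt
  have hZ : IsCompact (K ∩ w ⁻¹' Set.Iic 0) :=
    hKcpt.of_isClosed_subset (hwK.preimage_isClosed_of_isClosed hKcpt.isClosed isClosed_Iic)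
      Set.inter_subset_left
  obtain ⟨q, ⟨hqK, hqw⟩, hqmin⟩ := hZ.exists_isMinOn (f := fun z => ‖z - c‖)
    ⟨y, ⟨hy, by simp [dist_eq_norm]⟩, by simpa [hw] using hcon⟩ (by fun_prop)
  have hql := hKl q hqK
  have hqΩ : q ∈ Ω := by
    by_contra hq
    have hqf : q ∈ frontier Ω := by rw [hΩo.frontier_eq]; exact ⟨hqK.1, hq⟩
    have h1 := hpos _ (hrefl q hqK.1 hql)
    have h2 : w q ≤ 0 := hqw
    simp only [hw, hfr q hqf] at h2
    linarith
  have hqc : 0 < ‖q - c‖ := norm_pos_iff.2 (sub_ne_zero.2 (hne q hqK.1))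
  have hD : Ω ∩ Metric.ball c l ∈ 𝓝 q :=
    (hΩo.inter Metric.isOpen_ball).mem_nhds ⟨hqΩ, by simpa [dist_eq_norm] using hql⟩
  obtain ⟨R₀, hR₀, hR₀D⟩ := Metric.mem_nhds_iff.1 hD
  obtain ⟨R, hR, hRlt⟩ : ∃ R, 0 < R ∧ R < min (R₀ / 2) ‖q - c‖ :=
    exists_between (lt_min (half_pos hR₀) hqc)
  have hR1 := hRlt.trans_le (min_le_left _ _)
  have hR2 := hRlt.trans_le (min_le_right _ _)
  set t := R / (2 * ‖q - c‖) with ht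
  have htpos : 0 < t := by positivity
  have htlt : t < 1 := by rw [ht, div_lt_one (by positivity)]; linarith
  set p := q - t • (q - c) with hp
  have hqp : dist q p < R := by
    rw [dist_eq_norm, hp, sub_sub_cancel, norm_smul, Real.norm_of_nonneg htpos.le, ht]
    field_simp
    linarith
  have hsub : ∀ z ∈ Metric.closedBall p R, z ∈ Ω ∧ ‖z - c‖ < l := fun z hz => by
    have hzp : dist z p ≤ R := hz
    have : z ∈ Metric.ball q R₀ := by
      rw [Metric.mem_ball]
      have h1 := dist_triangle z p q
      have h2 := dist_comm p q
      linarith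
    have := hR₀D this
    exact ⟨this.1, by simpa [dist_eq_norm] using this.2⟩
  have hnn : ∀ z ∈ Metric.closedBall p R, 0 ≤ w z := fun z hz =>
    sub_nonneg.2 (hle z (subset_closure (hsub z hz).1) (hsub z hz).2.le)
  have hpc : ‖p - c‖ < ‖q - c‖ := by
    have : p - c = (1 - t) • (q - c) := by rw [hp, sub_smul, one_smul]; abel
    rw [this, norm_smul, Real.norm_of_nonneg (by linarith)]
    nlinarith
  have hwp : 0 < w p := by
    by_contra! hcon'
    have hpΩ := (hsub p (Metric.mem_closedBall_self hR.le)).1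
    have hqy : ‖q - c‖ ≤ ‖y - c‖ := by simpa [dist_eq_norm] using hqK.2
    have : ‖q - c‖ ≤ ‖p - c‖ := hqmin ⟨⟨subset_closure hpΩ, by
      simpa [dist_eq_norm] using hpc.le.trans hqy⟩, hcon'⟩
    linarith
  have := pos_of_superharmonic hC (fun z hz => hwd z (subset_closure (hsub z hz).1) (hsub z hz).2)
    hnn (fun z hz => by
      obtain ⟨hzΩ, hzl⟩ := hsub z hz
      have hz' := subset_closure hzΩ
      have hi := hrefl z hz' hzl
      have := lapl_reflection_sub_le hzΩ (hne z hz') hzl.le hi (hu z hz')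
        (hu _ (subset_closure hi)) heq (hf0 _ (hpos _ hi).le) (hLip z hz' _ (subset_closure hi))
      rwa [abs_of_nonneg (hnn z hz)] at this) hwp q hqp
  exact absurd hqw (not_le.2 this)

/-- If a bounded domain is reflected into itself by inversion in every circle about `c` of radius
at most `l₁`, then a positive solution is dominated by its reflections. -/
theorem le_reflection {Ω : Set Plane} {f : ℝ → ℝ} {u : Plane → ℝ} {c : Plane}
    {l₁ : ℝ} (hΩo : IsOpen Ω) (hΩb : Bornology.IsBounded Ω)
    (hu : ∀ x ∈ closure Ω, ContDiffAt ℝ 2 u x)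
    (hf : LocallyLipschitz f) (hf0 : ∀ s : ℝ, 0 ≤ s → 0 ≤ f s)
    (heq : ∀ x ∈ Ω, lapl u x + f (u x) = 0) (hfr : ∀ x ∈ frontier Ω, u x = 0)
    (hpos : ∀ x ∈ Ω, 0 < u x) (hc : c ∉ closure Ω)
    (hrefl : ∀ l ≤ l₁, ∀ y ∈ closure Ω, ‖y - c‖ < l → inversion c l y ∈ Ω) :
    ∀ l, 0 < l → l ≤ l₁ → ∀ y ∈ closure Ω, ‖y - c‖ ≤ l → u y ≤ u (inversion c l y) := by
  have hcpt : IsCompact (closure Ω) := hΩb.isCompact_closure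
  have hucont : ContinuousOn u (closure Ω) := fun x hx => (hu x hx).continuousAt.continuousWithinAt
  obtain ⟨C, hC, hLip⟩ := hf.exists_abs_sub_le_on_image hcpt hucont
  have hne : ∀ z ∈ closure Ω, z ≠ c := fun z hz h => hc (h ▸ hz)
  set S : Set ℝ := {l | ∀ y ∈ closure Ω, ‖y - c‖ ≤ l → u y ≤ u (inversion c l y)} with hS
  obtain ⟨r, hr, hrc⟩ : ∃ r > 0, ∀ y ∈ closure Ω, r < ‖y - c‖ := by
    obtain ⟨r, hr, hb⟩ := Metric.isOpen_iff.1 isClosed_closure.isOpen_compl c hc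
    refine ⟨r / 2, half_pos hr, fun y hy => ?_⟩
    by_contra! h
    exact hb (show y ∈ Metric.ball c r by rw [Metric.mem_ball, dist_eq_norm]; linarith) hy
  have hsmall : ∀ l ≤ r, l ∈ S := fun l hl y hy hyl => absurd (hrc y hy) (not_lt.2 (hyl.trans hl))
  have hsphere : ∀ (y : Plane) (l : ℝ), ‖y - c‖ = l → inversion c l y = y := fun y l h =>
    inversion_of_mem_sphere (by simpa [dist_eq_norm] using h)
  have hcontl : ∀ l ≤ l₁, ∀ y ∈ closure Ω, ‖y - c‖ < l →
      ContinuousAt (fun z : ℝ × Plane => u (inversion c z.1 z.2)) (l, y) := fun l hl y hy hyl =>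
    ContinuousAt.comp (f := fun z : ℝ × Plane => inversion c z.1 z.2)
      (hu _ (subset_closure (hrefl l hl y hy hyl))).continuousAt
      (continuousAt_const.inversion continuousAt_fst continuousAt_snd (hne y hy))
  intro l hl hll
  by_cases hlr : l ≤ r
  · exact hsmall l hlr
  push Not at hlr
  suffices h : Set.Icc r l ⊆ S from h ⟨hlr.le, le_rfl⟩
  refine IsClosed.Icc_subset_of_forall_exists_gt ?_ (hsmall r le_rfl) ?_
  · refine isClosed_of_closure_subset fun a ha => ?_
    have haI : a ∈ Set.Icc r l :=
      closure_minimal Set.inter_subset_right isClosed_Icc ha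
    refine ⟨fun y hy hya => ?_, haI⟩
    rcases hya.eq_or_lt with h | h
    · rw [hsphere y a h]
    · have hcont : ContinuousAt (fun s : ℝ => u (inversion c s y)) a :=
        ContinuousAt.comp (f := fun s : ℝ => (s, y)) (hcontl a (haI.2.trans hll) y hy h)
          (by fun_prop)
      obtain ⟨s, hs, hsa⟩ := mem_closure_iff_seq_limit.1 ha
      refine ge_of_tendsto (hcont.tendsto.comp hsa) ?_
      filter_upwards [hsa.eventually (lt_mem_nhds h)] with n hn
      exact (hs n).1 y hy hn.le
  · rintro a ⟨haS, har, hal⟩ b hb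
    have hapos : 0 < a := hr.trans_le har
    have hal₁ : a ≤ l₁ := hal.le.trans hll
    have hstrict := lt_reflection_of_le_reflection hΩo hΩb hu hf hf0 heq hfr hpos hc
      (hrefl a hal₁) haS
    set A := (C + 1) / (a ^ 2) with hA
    have hApos : 0 < A := by positivity
    obtain ⟨κ, hκ, hκ1, hκ2⟩ : ∃ κ > 0, κ ≤ a ^ 2 / 4 ∧ A * κ ^ 2 ≤ 1 := by
      refine ⟨min (a ^ 2 / 4) (min 1 (1 / A)), by positivity, min_le_left _ _, ?_⟩
      set k := min (a ^ 2 / 4) (min 1 (1 / A))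
      have h0 : 0 < k := by positivity
      have h1 : k ≤ 1 := (min_le_right _ _).trans (min_le_left _ _)
      have h2 : k ≤ 1 / A := (min_le_right _ _).trans (min_le_right _ _)
      have h3 : A * k ≤ 1 := by rw [mul_comm]; exact (le_div_iff₀ hApos).1 h2
      nlinarith
    set K := closure Ω ∩ {y | ‖y - c‖ ^ 2 ≤ a ^ 2 - κ} with hK
    have hKcpt : IsCompact K := hcpt.inter_right (isClosed_le (by fun_prop) (by fun_prop))
    have hev : ∀ᶠ s in 𝓝 a, ∀ y ∈ K, u y < u (inversion c s y) := by
      refine hKcpt.eventually_forall_of_forall_eventually fun y hy => ?_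
      have hya : ‖y - c‖ < a := lt_of_pow_lt_pow_left₀ 2 hapos.le (by linarith [hy.2.out])
      exact ContinuousAt.eventually_lt (f := fun z : ℝ × Plane => u z.2)
        (ContinuousAt.comp (f := Prod.snd) (hu y hy.1).continuousAt continuousAt_snd)
        (hcontl a hal₁ y hy.1 hya) (hstrict y hy.1 hya)
    have hev2 : ∀ᶠ s in 𝓝 a, s ^ 2 < a ^ 2 + κ :=
      (continuous_pow 2).continuousAt.eventually (gt_mem_nhds (by simpa using hκ))
    obtain ⟨s, hsab, ⟨hsK, hsκ⟩, hsl⟩ : ∃ s ∈ Set.Ioc a b,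
        ((∀ y ∈ K, u y < u (inversion c s y)) ∧ s ^ 2 < a ^ 2 + κ) ∧ s < l := by
      have h1 : ∀ᶠ s in 𝓝[>] a, _ := nhdsWithin_le_nhds ((hev.and hev2).and (gt_mem_nhds hal))
      have h2 : ∀ᶠ s in 𝓝[>] a, s ∈ Set.Ioc a b := Ioc_mem_nhdsGT hb
      exact (h2.and h1).exists
    have hsl₁ : s ≤ l₁ := hsl.le.trans hll
    refine ⟨s, fun y hy hys => ?_, hsab⟩
    by_cases hyK : y ∈ K
    · exact (hsK y hyK).le
    have hyK' : a ^ 2 - κ ≤ ‖y - c‖ ^ 2 := by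
      by_contra! h
      exact hyK ⟨hy, h.le⟩
    set w : Plane → ℝ := fun z => u (inversion c s z) - u z with hw
    set T := closure Ω ∩ {z | a ^ 2 - κ ≤ ‖z - c‖ ^ 2 ∧ ‖z - c‖ ≤ s} with hT
    have hTcpt : IsCompact T := hcpt.inter_right (by
      rw [Set.ofPred_and]
      exact (isClosed_le (by fun_prop) (by fun_prop)).inter
        (isClosed_le (by fun_prop) (by fun_prop)))
    have hiclos : ∀ z ∈ T, inversion c s z ∈ closure Ω := fun z hz => by
      rcases hz.2.2.eq_or_lt with h | h
      · rw [hsphere z s h]; exact hz.1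
      · exact subset_closure (hrefl s hsl₁ z hz.1 h)
    have hwT : ContinuousOn w T := fun z hz =>
      (contDiffAt_reflection_sub (hne z hz.1) (hu z hz.1)
        (hu _ (hiclos z hz))).continuousAt.continuousWithinAt
    refine sub_nonneg.1 (nonneg_of_narrow hTcpt hwT (c := c) (τ := a ^ 2) hC hApos.le hκ1 hκ2 ?_
      ?_ ?_ y ⟨hy, hyK', hys⟩)
    · rw [hA]; field_simp; linarith
    · intro z hz
      have := pow_le_pow_left₀ (norm_nonneg _) hz.2.2 2
      exact abs_le.2 ⟨by linarith [hz.2.1], by linarith⟩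
    · intro z hz hwz
      have hzs : ‖z - c‖ < s := by
        refine hz.2.2.lt_of_ne fun h => ?_
        simp [hw, hsphere z s h] at hwz
      have hi := hrefl s hsl₁ z hz.1 hzs
      have hzΩ : z ∈ Ω := by
        by_contra hcon
        have hzf : z ∈ frontier Ω := by rw [hΩo.frontier_eq]; exact ⟨hz.1, hcon⟩
        have := hpos _ hi
        simp only [hw, hfr z hzf] at hwz
        linarith
      have hza : a ^ 2 - κ < ‖z - c‖ ^ 2 := by
        by_contra! h
        have := hsK z ⟨hz.1, h⟩
        simp only [hw] at hwz
        linarith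
      refine ⟨?_, contDiffAt_reflection_sub (hne z hz.1) (hu z hz.1) (hu _ (hiclos z hz)), ?_⟩
      · have hcn : ContinuousAt (fun z : Plane => ‖z - c‖) z := by fun_prop
        filter_upwards [hΩo.mem_nhds hzΩ, (hcn.pow 2).eventually (lt_mem_nhds hza),
          hcn.eventually (gt_mem_nhds hzs)] with x h1 h2 h3
        exact ⟨subset_closure h1, h2.le, h3.le⟩
      · have := lapl_reflection_sub_le hzΩ (hne z hz.1) hzs.le hi (hu z hz.1)
          (hu _ (hiclos z hz)) heq (hf0 _ (hpos _ hi).le) (hLip z hz.1 _ (hiclos z hz))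
        rwa [abs_of_neg hwz, mul_neg] at this

/-! ### Boundary geometry of smooth planar domains -/

lemma fderiv_eq_inner_gradient (ψ : Plane → ℝ) (x v : Plane) :
    fderiv ℝ ψ x v = inner ℝ (gradient ψ x) v := by
  rw [gradient, InnerProductSpace.toDual_symm_apply]

lemma exists_quadratic_remainder {ψ : Plane → ℝ} (hψ : ContDiff ℝ 2 ψ) (z : Plane) :
    ∃ K s : ℝ, 0 ≤ K ∧ 0 < s ∧ ∀ y ∈ Metric.ball z s,
      |ψ y - ψ z - inner ℝ (gradient ψ z) (y - z)| ≤ K * ‖y - z‖ ^ 2 := by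
  obtain ⟨K, t, ht, hK⟩ := ((hψ.contDiffAt (x := z)).fderiv_right (m := 1)
    (by norm_num)).exists_lipschitzOnWith
  obtain ⟨s, hs, hst⟩ := Metric.mem_nhds_iff.1 ht
  refine ⟨K, s, K.2, hs, fun y hy => ?_⟩
  have hsub : Metric.closedBall z ‖y - z‖ ⊆ t := by
    refine (Metric.closedBall_subset_ball ?_).trans hst
    simpa [dist_eq_norm] using hy
  have := (convex_closedBall z ‖y - z‖).norm_image_sub_le_of_norm_hasFDerivWithin_le'
    (f := ψ) (f' := fderiv ℝ ψ) (φ := fderiv ℝ ψ z) (C := K * ‖y - z‖) (x := z) (y := y)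
    (fun x _ => ((hψ.differentiable (by norm_num)) x).hasFDerivAt.hasFDerivWithinAt)
    (fun x hx => by
      have h1 := hK.dist_le_mul x (hsub hx) z (mem_of_mem_nhds ht)
      rw [dist_eq_norm, dist_eq_norm] at h1
      have h2 : ‖x - z‖ ≤ ‖y - z‖ := by simpa [dist_eq_norm] using hx
      exact h1.trans (mul_le_mul_of_nonneg_left h2 K.2))
    (Metric.mem_closedBall_self (norm_nonneg _)) (by simp [dist_eq_norm])
  rw [fderiv_eq_inner_gradient, Real.norm_eq_abs] at this
  linarith

/-- A `C²` sublevel set has exterior tangent balls at its regular boundary points. -/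
lemma exists_exterior_ball {ψ : Plane → ℝ} (hψ : ContDiff ℝ 2 ψ) {z : Plane} (hz : ψ z = 0)
    (hg : gradient ψ z ≠ 0) :
    ∃ t : ℝ, 0 < t ∧ ∀ y, ‖y - (z + t • gradient ψ z)‖ ≤ t * ‖gradient ψ z‖ → ψ y ≤ 0 → y = z := by
  obtain ⟨K, s, hK, hs, hT⟩ := exists_quadratic_remainder hψ z
  set g := gradient ψ z
  have hgn : 0 < ‖g‖ := norm_pos_iff.2 hg
  obtain ⟨t, ht, htlt⟩ : ∃ t, 0 < t ∧ t < min (s / (2 * ‖g‖)) (1 / (2 * K + 1)) :=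
    exists_between (by positivity)
  have ht1 : 2 * (t * ‖g‖) < s := by
    have := htlt.trans_le (min_le_left _ _)
    rw [lt_div_iff₀ (by positivity)] at this
    linarith
  have ht2 : 2 * (t * K) < 1 := by
    have := htlt.trans_le (min_le_right _ _)
    rw [lt_div_iff₀ (by positivity)] at this
    linarith
  refine ⟨t, ht, fun y hy hψy => ?_⟩
  have hnt : ‖t • g‖ = t * ‖g‖ := by rw [norm_smul, Real.norm_of_nonneg ht.le]
  have hysub : y - (z + t • g) = (y - z) - t • g := by abel
  rw [hysub] at hy
  have hball : y ∈ Metric.ball z s := by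
    rw [Metric.mem_ball, dist_eq_norm]
    have := norm_sub_norm_le (y - z) (t • g)
    linarith
  have hsq : ‖y - z‖ ^ 2 ≤ 2 * t * inner ℝ g (y - z) := by
    have h1 := pow_le_pow_left₀ (norm_nonneg _) hy 2
    rw [norm_sub_sq_real, inner_smul_right, real_inner_comm, hnt] at h1
    linarith
  have h2 := neg_le_of_abs_le (hT y hball)
  rw [hz] at h2
  have h3 : ‖y - z‖ ^ 2 * (1 - 2 * (t * K)) ≤ 0 := by nlinarith
  have h4 : ‖y - z‖ ^ 2 ≤ 0 := by nlinarith [sq_nonneg ‖y - z‖]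
  exact sub_eq_zero.1 (norm_eq_zero.1 (pow_eq_zero_iff two_ne_zero |>.1
    (le_antisymm h4 (sq_nonneg _))))

lemma norm_inversion_sub {c y : Plane} {l : ℝ} (hyc : y ≠ c) (hl : ‖y - c‖ ≤ l) :
    ‖inversion c l y - y‖ = (l ^ 2 - ‖y - c‖ ^ 2) / ‖y - c‖ := by
  have hn : 0 < ‖y - c‖ := norm_pos_iff.2 (sub_ne_zero.2 hyc)
  have h : inversion c l y - y = (l ^ 2 / ‖y - c‖ ^ 2 - 1) • (y - c) := by
    rw [inversion_eq, sub_smul, one_smul]; abel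
  have h1 : 1 ≤ l ^ 2 / ‖y - c‖ ^ 2 :=
    (one_le_div (by positivity)).2 (pow_le_pow_left₀ hn.le hl 2)
  rw [h, norm_smul, Real.norm_of_nonneg (by linarith)]
  field_simp

/-- Near a regular boundary point, inversions in circles about points close to the centre of an
exterior tangent ball map the part of the domain inside the circle into the domain. -/
lemma exists_inversion_mem {Ω : Set Plane} {ψ : Plane → ℝ} (hΩb : Bornology.IsBounded Ω)
    (hψ : ContDiff ℝ 2 ψ) (hΩ : Ω = {x | ψ x < 0}) {z : Plane} (hz : ψ z = 0)
    (hg : gradient ψ z ≠ 0) :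
    ∃ (c₀ : Plane) (r δ : ℝ), 0 < δ ∧ δ ≤ r ∧ ‖z - c₀‖ = r ∧ ∀ c ∈ Metric.ball c₀ δ,
      c ∉ closure Ω ∧
      ∀ l ≤ r + 4 * δ, ∀ y ∈ closure Ω, ‖y - c‖ < l → inversion c l y ∈ Ω := by
  obtain ⟨t, ht, hext⟩ := exists_exterior_ball hψ hz hg
  set g := gradient ψ z with hgdef
  have hgn : 0 < ‖g‖ := norm_pos_iff.2 hg
  set c₀ := z + t • g with hc₀
  set r := t * ‖g‖ with hr
  have hrpos : 0 < r := by positivity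
  have hzc : ‖z - c₀‖ = r := by
    rw [hc₀, sub_add_cancel_left, norm_neg, norm_smul, Real.norm_of_nonneg ht.le]
  have hclos : ∀ y ∈ closure Ω, ψ y ≤ 0 := fun y hy =>
    closure_minimal (t := {x | ψ x ≤ 0}) (by rw [hΩ]; exact fun x hx => hx.out.le)
      (isClosed_le hψ.continuous continuous_const) hy
  have hfar : ∀ y ∈ closure Ω, r ≤ ‖y - c₀‖ := fun y hy => by
    by_contra! h
    have := hext y h.le (hclos y hy)
    rw [this, hzc] at h
    exact lt_irrefl _ h
  obtain ⟨s, hs, hneg⟩ : ∃ s > 0, ∀ y ∈ Metric.ball z s, ∀ c ∈ Metric.ball c₀ s,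
      fderiv ℝ ψ y (y - c) < 0 := by
    have hcont : Continuous fun q : Plane × Plane => fderiv ℝ ψ q.1 (q.1 - q.2) :=
      ((hψ.continuous_fderiv (by norm_num)).comp continuous_fst).clm_apply
        (continuous_fst.sub continuous_snd)
    have h0 : fderiv ℝ ψ z (z - c₀) < 0 := by
      rw [fderiv_eq_inner_gradient, hc₀, sub_add_cancel_left, inner_neg_right, inner_smul_right,
        real_inner_self_eq_norm_sq]
      have : 0 < t * ‖g‖ ^ 2 := by positivity
      linarith
    obtain ⟨s, hs, hb⟩ := Metric.eventually_nhds_iff_ball.1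
      ((hcont.continuousAt (x := (z, c₀))).eventually (gt_mem_nhds h0))
    exact ⟨s, hs, fun y hy c hc => hb (y, c) (by
      rw [← ball_prod_same]; exact ⟨hy, hc⟩)⟩
  obtain ⟨r', hr', hfar'⟩ : ∃ r', r < r' ∧ ∀ y ∈ closure Ω \ Metric.ball z (s / 2),
      r' ≤ ‖y - c₀‖ := by
    refine (hΩb.isCompact_closure.diff Metric.isOpen_ball).exists_forall_le'
      (by fun_prop) fun y hy => (hfar y hy.1).lt_of_ne fun h => ?_
    have := hext y h.symm.le (hclos y hy.1)
    exact hy.2 (this ▸ Metric.mem_ball_self (half_pos hs))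
  obtain ⟨δ, hδ, hδlt⟩ : ∃ δ, 0 < δ ∧ δ < min ((r' - r) / 10) (min (s / 200) (r / 2)) :=
    exists_between (by have := sub_pos.2 hr'; positivity)
  have hδ1 := hδlt.trans_le (min_le_left _ _)
  have hδ2 := hδlt.trans_le ((min_le_right _ _).trans (min_le_left _ _))
  have hδ3 := hδlt.trans_le ((min_le_right _ _).trans (min_le_right _ _))
  refine ⟨c₀, r, δ, hδ, by linarith, hzc, fun c hc => ?_⟩
  have hcc : ‖c - c₀‖ < δ := by simpa [dist_eq_norm] using hc
  have hcΩ : c ∉ closure Ω := fun h => by linarith [hfar c h]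
  refine ⟨hcΩ, fun l hl y hy hyl => ?_⟩
  have hyc : y ≠ c := fun h => hcΩ (h ▸ hy)
  have htri1 : ‖y - c₀‖ ≤ ‖y - c‖ + ‖c - c₀‖ := norm_sub_le_norm_sub_add_norm_sub y c c₀
  have hd : r - δ ≤ ‖y - c‖ := by linarith [hfar y hy]
  set d := ‖y - c‖ with hdd
  have hdpos : 0 < d := by linarith
  have hyball : y ∈ Metric.ball z (s / 2) := by
    by_contra h
    linarith [hfar' y ⟨hy, h⟩]
  have hiball : inversion c l y ∈ Metric.ball z s := by
    have h1 : ‖inversion c l y - y‖ < s / 2 := by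
      rw [norm_inversion_sub hyc hyl.le, ← hdd, div_lt_iff₀ hdpos]
      have h2 : l ^ 2 ≤ (r + 4 * δ) ^ 2 := pow_le_pow_left₀ (by linarith) hl 2
      have h3 : (r - δ) ^ 2 ≤ d ^ 2 := pow_le_pow_left₀ (by linarith) hd 2
      nlinarith
    rw [Metric.mem_ball]
    have := dist_triangle (inversion c l y) y z
    rw [dist_eq_norm (inversion c l y) y] at this
    linarith [Metric.mem_ball.1 hyball]
  have hT : 1 < l ^ 2 / d ^ 2 :=
    (one_lt_div (by positivity)).2 (pow_lt_pow_left₀ hyl hdpos.le two_ne_zero)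
  have hderiv : ∀ τ : ℝ, HasDerivAt (fun τ : ℝ => ψ (c + τ • (y - c)))
      (fderiv ℝ ψ (c + τ • (y - c)) (y - c)) τ := fun τ =>
    (hψ.differentiable (by norm_num) _).hasFDerivAt.comp_hasDerivAt τ
      (by simpa using ((hasDerivAt_id τ).smul_const (y - c)).const_add c)
  have hanti : StrictAntiOn (fun τ : ℝ => ψ (c + τ • (y - c))) (Set.Icc 1 (l ^ 2 / d ^ 2)) := by
    refine strictAntiOn_of_deriv_neg (convex_Icc _ _)
      (fun τ _ => (hderiv τ).continuousAt.continuousWithinAt) fun τ hτ => ?_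
    rw [interior_Icc] at hτ
    rw [(hderiv τ).deriv]
    have hmem : c + τ • (y - c) ∈ Metric.ball z s := by
      have hconv : Convex ℝ ((fun τ : ℝ => c + τ • (y - c)) ⁻¹' Metric.ball z s) := by
        have : (fun τ : ℝ => c + τ • (y - c)) = AffineMap.lineMap c y := by
          ext1 τ; rw [AffineMap.lineMap_apply]; simp [add_comm]
        rw [this]
        exact (convex_ball z s).affine_preimage _
      refine hconv.ordConnected.out (x := 1) (y := l ^ 2 / d ^ 2) ?_ ?_ ⟨hτ.1.le, hτ.2.le⟩
      · simpa using Metric.ball_subset_ball (by linarith) hyball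
      · simpa [inversion_eq] using hiball
    have h1 := hneg _ hmem c (Metric.ball_subset_ball (by linarith) hc)
    rw [add_sub_cancel_left, map_smul, smul_eq_mul] at h1
    exact (mul_neg_iff.1 h1).elim And.right fun h => by linarith [h.1, hτ.1]
  have := hanti ⟨le_rfl, hT.le⟩ ⟨hT.le, le_rfl⟩ hT
  have hy0 := hclos y hy
  rw [hΩ, Set.mem_ofPred_eq, inversion_eq, ← hdd]
  simp only [one_smul, add_sub_cancel] at this
  linarith

/-! ### The boundary estimate -/

lemma IsClassicalSol.contDiffAt {Ω : Set Plane} {f : ℝ → ℝ} {u : Plane → ℝ}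
    (hu : IsClassicalSol Ω f u) : ∀ x ∈ closure Ω, ContDiffAt ℝ 2 u x := by
  obtain ⟨⟨U, hU, hΩU, huU⟩, -⟩ := hu
  exact fun x hx => huU.contDiffAt (hU.mem_nhds (hΩU hx))

lemma measureReal_ball_mul_le_setIntegral {Ω : Set Plane} {u : Plane → ℝ} {p : Plane} {R a : ℝ}
    (hΩo : IsOpen Ω) (hint : IntegrableOn u Ω) (hnonneg : ∀ y ∈ Ω, 0 ≤ u y)
    (hsub : Metric.ball p R ⊆ Ω) (ha : ∀ y ∈ Metric.ball p R, a ≤ u y) :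
    volume.real (Metric.ball (0 : Plane) R) * a ≤ ∫ y in Ω, u y := by
  have hfin : volume (Metric.ball p R) ≠ ⊤ := measure_ball_lt_top.ne
  calc volume.real (Metric.ball (0 : Plane) R) * a
      = ∫ _ in Metric.ball p R, a := by
        rw [setIntegral_const, smul_eq_mul, Measure.real, Measure.real,
          Measure.addHaar_ball_center volume p R]
    _ ≤ ∫ y in Metric.ball p R, u y :=
        setIntegral_mono_on (integrableOn_const hfin) (hint.mono_set hsub)
          Metric.isOpen_ball.measurableSet ha
    _ ≤ ∫ y in Ω, u y :=
        setIntegral_mono_set hint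
          ((ae_restrict_mem hΩo.measurableSet).mono fun y hy => hnonneg y hy)
          hsub.eventuallyLE

lemma exists_boundary_estimate_near {Ω : Set Plane} {ψ : Plane → ℝ} (hΩo : IsOpen Ω)
    (hΩb : Bornology.IsBounded Ω) (hψ : ContDiff ℝ 2 ψ) (hΩ : Ω = {x | ψ x < 0}) {z : Plane}
    (hz : ψ z = 0) (hg : gradient ψ z ≠ 0) :
    ∃ δ γ : ℝ, 0 < δ ∧ 0 < γ ∧
      ∀ f : ℝ → ℝ, LocallyLipschitz f → (∀ s : ℝ, 0 ≤ s → 0 ≤ f s) →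
      ∀ u : Plane → ℝ, IsClassicalSol Ω f u → (∀ x ∈ Ω, 0 < u x) →
        ∀ x ∈ Ω, x ∈ Metric.ball z δ → γ * u x ≤ ∫ y in Ω, u y := by
  obtain ⟨c₀, r, δ, hδ, hδr, hzc, hinv⟩ := exists_inversion_mem hΩb hψ hΩ hz hg
  have hr : 0 < r := hδ.trans_le hδr
  set t := δ / r with ht
  have htpos : 0 < t := by positivity
  have htr : t * r = δ := by rw [ht, div_mul_cancel₀ _ hr.ne']
  have ht1 : t ≤ 1 := by rw [ht, div_le_one hr]; exact hδr
  refine ⟨δ, volume.real (Metric.ball (0 : Plane) (t * δ)), hδ,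
    ENNReal.toReal_pos (Metric.measure_ball_pos _ _ (by positivity)).ne' measure_ball_lt_top.ne,
    fun f hf hf0 u hu hpos x hx hxz => ?_⟩
  have hud := hu.contDiffAt
  have hint : IntegrableOn u Ω :=
    (ContinuousOn.integrableOn_compact hΩb.isCompact_closure
      fun y hy => (hud y hy).continuousAt.continuousWithinAt).mono_set subset_closure
  have key : ∀ c ∈ Metric.ball c₀ δ, x + t • (x - c) ∈ Ω ∧ u x ≤ u (x + t • (x - c)) := by
    intro c hc
    obtain ⟨hcΩ, hinvc⟩ := hinv c hc
    have hxc : x ≠ c := fun h => hcΩ (h ▸ subset_closure hx)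
    have hd : 0 < ‖x - c‖ := norm_pos_iff.2 (sub_ne_zero.2 hxc)
    have hdle : ‖x - c‖ ≤ r + 2 * δ := by
      have h1 := norm_sub_le_norm_sub_add_norm_sub x z c
      have h2 := norm_sub_le_norm_sub_add_norm_sub z c₀ c
      have h3 : ‖x - z‖ < δ := by simpa [dist_eq_norm] using hxz
      have h4 : ‖c₀ - c‖ < δ := by rw [norm_sub_rev]; simpa [dist_eq_norm] using hc
      linarith
    set l := ‖x - c‖ * √(1 + t) with hl
    have hsq : l ^ 2 = ‖x - c‖ ^ 2 * (1 + t) := by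
      rw [hl, mul_pow, Real.sq_sqrt (by linarith)]
    have hlt : ‖x - c‖ < l := by
      have : 1 < √(1 + t) := Real.lt_sqrt_of_sq_lt (by linarith)
      rw [hl]; nlinarith
    have hll : l ≤ r + 4 * δ := by
      refine le_of_sq_le_sq ?_ (by linarith)
      have h1 : ‖x - c‖ ^ 2 ≤ (r + 2 * δ) ^ 2 := pow_le_pow_left₀ hd.le hdle 2
      rw [hsq]
      calc ‖x - c‖ ^ 2 * (1 + t) ≤ (r + 2 * δ) ^ 2 * (1 + t) :=
            mul_le_mul_of_nonneg_right h1 (by linarith)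
        _ = (r + 2 * δ) ^ 2 + (t * r) * r + 4 * δ * (t * r) + 4 * δ ^ 2 * t := by ring
        _ ≤ (r + 4 * δ) ^ 2 := by rw [htr]; nlinarith [sq_nonneg δ]
    have hi : inversion c l x = x + t • (x - c) := by
      rw [inversion_eq, hsq, mul_div_cancel_left₀ _ (by positivity), add_smul, one_smul]
      abel
    rw [← hi]
    exact ⟨hinvc l hll x (subset_closure hx) hlt,
      le_reflection hΩo hΩb hud hf hf0 hu.2.1 hu.2.2 hpos hcΩ hinvc l (hd.trans hlt) hll x
        (subset_closure hx) hlt.le⟩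
  have key2 : ∀ y ∈ Metric.ball (x + t • (x - c₀)) (t * δ), y ∈ Ω ∧ u x ≤ u y := by
    intro y hy
    have hyc : y = x + t • (x - (x - t⁻¹ • (y - x))) := by
      rw [sub_sub_cancel, smul_inv_smul₀ htpos.ne']; abel
    rw [hyc]
    refine key _ ?_
    have h1 : ‖y - (x + t • (x - c₀))‖ < t * δ := by simpa [dist_eq_norm] using hy
    have h2 : x - t⁻¹ • (y - x) - c₀ = -(t⁻¹ • (y - (x + t • (x - c₀)))) := by
      rw [← sub_sub, smul_sub t⁻¹ (y - x), inv_smul_smul₀ htpos.ne']; abel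
    rw [Metric.mem_ball, dist_eq_norm, h2, norm_neg, norm_smul,
      Real.norm_of_nonneg (by positivity), inv_mul_lt_iff₀ htpos]
    exact h1
  exact measureReal_ball_mul_le_setIntegral hΩo hint (fun y hy => (hpos y hy).le)
    (fun y hy => (key2 y hy).1) fun y hy => (key2 y hy).2

/-- (Boundary estimate in the plane without convexity,
Chen–Li.) -/
theorem boundary_estimate_plane
    (Ω : Set (EuclideanSpace ℝ (Fin 2))) (hΩ : IsSmoothBoundedDomain Ω) :
    ∃ ρ γ : ℝ, 0 < ρ ∧ 0 < γ ∧
      ∀ f : ℝ → ℝ, LocallyLipschitz f → (∀ s : ℝ, 0 ≤ s → 0 ≤ f s) →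
      ∀ u : EuclideanSpace ℝ (Fin 2) → ℝ,
        IsClassicalSol Ω f u → (∀ x ∈ Ω, 0 < u x) →
        ∀ x ∈ Ω, Metric.infDist x (frontier Ω) < ρ →
          u x ≤ (1 / γ) * ∫ y in Ω, u y := by
  obtain ⟨hΩo, hΩb, hne, ψ, hψ, hΩeq, hfreq, hgrad⟩ := hΩ
  have hψ2 : ContDiff ℝ 2 ψ := hψ.of_le (WithTop.coe_le_coe.2 (le_top : (2 : ℕ∞) ≤ ⊤))
  have hfc : IsCompact (frontier Ω) :=
    hΩb.isCompact_closure.of_isClosed_subset isClosed_frontier frontier_subset_closure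
  have hfne : (frontier Ω).Nonempty :=
    nonempty_frontier_iff.2 ⟨hne, fun h => NormedSpace.unbounded_univ ℝ Plane (h ▸ hΩb)⟩
  obtain ⟨V, hVo, hV, γ, hγ, hest⟩ : ∃ V, IsOpen V ∧ frontier Ω ⊆ V ∧ ∃ γ : ℝ, 0 < γ ∧
      ∀ f : ℝ → ℝ, LocallyLipschitz f → (∀ s : ℝ, 0 ≤ s → 0 ≤ f s) →
      ∀ u : Plane → ℝ, IsClassicalSol Ω f u → (∀ x ∈ Ω, 0 < u x) →
        ∀ x ∈ Ω, x ∈ V → γ * u x ≤ ∫ y in Ω, u y := by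
    refine hfc.induction_on (p := fun s => ∃ V, IsOpen V ∧ s ⊆ V ∧ ∃ γ : ℝ, 0 < γ ∧
      ∀ f : ℝ → ℝ, LocallyLipschitz f → (∀ s : ℝ, 0 ≤ s → 0 ≤ f s) →
      ∀ u : Plane → ℝ, IsClassicalSol Ω f u → (∀ x ∈ Ω, 0 < u x) →
        ∀ x ∈ Ω, x ∈ V → γ * u x ≤ ∫ y in Ω, u y) ?_ ?_ ?_ ?_
    · exact ⟨∅, isOpen_empty, subset_rfl, 1, one_pos, fun _ _ _ _ _ _ _ _ h => h.elim⟩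
    · rintro s t hst ⟨V, hVo, hV, h⟩
      exact ⟨V, hVo, hst.trans hV, h⟩
    · rintro s t ⟨V, hVo, hV, γ, hγ, h⟩ ⟨W, hWo, hW, γ', hγ', h'⟩
      refine ⟨V ∪ W, hVo.union hWo, Set.union_subset_union hV hW, min γ γ', lt_min hγ hγ',
        fun f hf hf0 u hu hpos x hx hxV => ?_⟩
      rcases hxV with hxV | hxW
      · exact (mul_le_mul_of_nonneg_right (min_le_left _ _) (hpos x hx).le).trans
          (h f hf hf0 u hu hpos x hx hxV)
      · exact (mul_le_mul_of_nonneg_right (min_le_right _ _) (hpos x hx).le).trans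
          (h' f hf hf0 u hu hpos x hx hxW)
    · intro z hz
      obtain ⟨δ, γ, hδ, hγ, h⟩ := exists_boundary_estimate_near hΩo hΩb hψ2 hΩeq
        (by rw [hfreq] at hz; exact hz) (hgrad z hz)
      exact ⟨Metric.ball z δ, mem_nhdsWithin_of_mem_nhds (Metric.ball_mem_nhds z hδ),
        Metric.ball z δ, Metric.isOpen_ball, subset_rfl, γ, hγ, h⟩
  obtain ⟨ρ, hρ, hthick⟩ := hfc.exists_thickening_subset_open hVo hV
  refine ⟨ρ, γ, hρ, hγ, fun f hf hf0 u hu hpos x hx hdist => ?_⟩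
  obtain ⟨z, hz, hxz⟩ := (Metric.infDist_lt_iff hfne).1 hdist
  have := hest f hf hf0 u hu hpos x hx (hthick (Metric.mem_thickening_iff.2 ⟨z, hz, hxz⟩))
  rw [one_div, le_inv_mul_iff₀ hγ]
  exact this
end
end

section
/- (Regularized stability inequality.) Let Ω ⊆ ℝⁿ be a bounded smooth domain, f : ℝ → ℝ a C∞ function, and u a classical semi-stable solution of −Δu = f(u) in Ω with u = 0 on ∂Ω, with u C∞ on a neighborhood of the closure of Ω. Then for every Lipschitz function η : ℝⁿ → ℝ vanishing on frontier Ω and every ε > 0: ∫_Ω (‖∇u(x)‖² + ε²) ‖∇η(x)‖² dx ≥ ∫_Ω f'(u(x)) ε² η(x)² dx + ∫_Ω ( ‖D²u(x)‖_F² − ‖D²u(x)·∇u(x)‖² / (‖∇u(x)‖² + ε²) ) η(x)² dx, where D²u(x) is the Hessian matrix of u at x, ‖D²u(x)‖_F² = Σ_{i,j} (∂_i∂_j u(x))², and D²u(x)·∇u(x) is the vector with i-th component Σ_j ∂_i∂_j u(x) ∂_j u(x). -/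
open MeasureTheory Filter

noncomputable section

/-- The partial derivative of `v` in the `i`-th coordinate direction. -/
def partialD {n : ℕ} (i : Fin n) (v : EuclideanSpace ℝ (Fin n) → ℝ)
    (x : EuclideanSpace ℝ (Fin n)) : ℝ :=
  fderiv ℝ v x (EuclideanSpace.single i 1)

section partialD

variable {n : ℕ} {v : EuclideanSpace ℝ (Fin n) → ℝ}

lemma contDiff_partialD (hv : ContDiff ℝ (⊤ : ℕ∞) v) (i : Fin n) :
    ContDiff ℝ (⊤ : ℕ∞) (partialD i v) :=
  (hv.fderiv_right (m := ((⊤ : ℕ∞) : WithTop ℕ∞)) le_rfl).clm_apply contDiff_const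

lemma hasCompactSupport_partialD (hv : HasCompactSupport v) (i : Fin n) :
    HasCompactSupport (partialD i v) :=
  hv.fderiv_apply (𝕜 := ℝ) _

lemma partialD_comm (hv : ContDiff ℝ (⊤ : ℕ∞) v) (i j : Fin n) :
    partialD i (partialD j v) = partialD j (partialD i v) := by
  have hd : Differentiable ℝ (fderiv ℝ v) :=
    (hv.fderiv_right (m := ((⊤ : ℕ∞) : WithTop ℕ∞)) le_rfl).differentiable (by simp)
  have key : ∀ (k l : Fin n) x, partialD k (partialD l v) x =
      fderiv ℝ (fderiv ℝ v) x (EuclideanSpace.single k 1) (EuclideanSpace.single l 1) := by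
    intro k l x
    have h := ((hd x).hasFDerivAt.clm_apply
      (hasFDerivAt_const (EuclideanSpace.single l (1 : ℝ)) x)).fderiv
    change fderiv ℝ (fun y => fderiv ℝ v y (EuclideanSpace.single l 1)) x _ = _
    rw [h]
    simp
  funext x
  rw [key, key]
  refine (hv.contDiffAt (x := x)).isSymmSndFDerivAt ?_ _ _
  simp only [minSmoothness_of_isRCLikeNormedField]
  exact WithTop.coe_le_coe.2 le_top

lemma gradient_apply_eq_partialD (x : EuclideanSpace ℝ (Fin n)) (j : Fin n) :
    gradient v x j = partialD j v x := by
  have h := EuclideanSpace.inner_single_right j (1 : ℝ) (gradient v x)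
  rw [inner_gradient_left] at h
  simpa [partialD] using h.symm

lemma norm_gradient_sq_eq_sum (x : EuclideanSpace ℝ (Fin n)) :
    ‖gradient v x‖ ^ 2 = ∑ i, partialD i v x ^ 2 := by
  rw [EuclideanSpace.real_norm_sq_eq]
  simp [gradient_apply_eq_partialD]

lemma partialD_sum_sq (hv : ContDiff ℝ (⊤ : ℕ∞) v) (i : Fin n) :
    partialD i (fun x => ∑ j, partialD j v x ^ 2) =
      fun x => 2 * ∑ j, partialD i (partialD j v) x * partialD j v x := by
  funext x
  have hd : ∀ j, HasFDerivAt (partialD j v) (fderiv ℝ (partialD j v) x) x := fun j =>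
    ((contDiff_partialD hv j).differentiable (by simp) x).hasFDerivAt
  have h := (HasFDerivAt.fun_sum (u := Finset.univ) fun j _ => (hd j).pow 2).fderiv
  rw [partialD, h]
  simp only [sum_apply, Finset.mul_sum]
  refine Finset.sum_congr rfl fun j _ => ?_
  simp only [smul_apply, smul_eq_mul, partialD]
  simp
  ring

lemma partialD_partialD_sum_sq (hv : ContDiff ℝ (⊤ : ℕ∞) v) (i : Fin n)
    (x : EuclideanSpace ℝ (Fin n)) :
    partialD i (partialD i (fun x => ∑ j, partialD j v x ^ 2)) x =
      2 * ∑ j, (partialD i (partialD j v) x ^ 2 +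
        partialD j v x * partialD i (partialD i (partialD j v)) x) := by
  rw [partialD_sum_sq hv]
  have hd : ∀ {w : EuclideanSpace ℝ (Fin n) → ℝ}, ContDiff ℝ (⊤ : ℕ∞) w →
      HasFDerivAt w (fderiv ℝ w x) x := fun hw => (hw.differentiable (by simp) x).hasFDerivAt
  have h := ((HasFDerivAt.fun_sum (u := Finset.univ) fun j _ =>
    (hd (contDiff_partialD (contDiff_partialD hv j) i)).fun_mul
      (hd (contDiff_partialD hv j))).const_mul 2).fderiv
  rw [partialD, h]
  simp only [sum_apply, smul_apply, smul_eq_mul,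
    add_apply]
  congr 1
  refine Finset.sum_congr rfl fun j _ => ?_
  simp only [partialD]
  ring

/-- The Bochner formula for solutions of `-Δv = f(v)`. -/
lemma sum_partialD_partialD_norm_sq {Ω : Set (EuclideanSpace ℝ (Fin n))} (hΩ : IsOpen Ω)
    {f : ℝ → ℝ} (hf : ContDiff ℝ (⊤ : ℕ∞) f) (hv : ContDiff ℝ (⊤ : ℕ∞) v)
    (hsol : ∀ x ∈ Ω, lapl v x + f (v x) = 0) {x : EuclideanSpace ℝ (Fin n)} (hx : x ∈ Ω) :
    ∑ i, partialD i (partialD i (fun x => ∑ j, partialD j v x ^ 2)) x =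
      2 * (∑ i, ∑ j, partialD i (partialD j v) x ^ 2 -
        deriv f (v x) * ∑ j, partialD j v x ^ 2) := by
  have hthird : ∀ j, ∑ i, partialD i (partialD i (partialD j v)) x =
      -(deriv f (v x) * partialD j v x) := by
    intro j
    have h1 : ∀ i, partialD i (partialD i (partialD j v)) x =
        fderiv ℝ (partialD i (partialD i v)) x (EuclideanSpace.single j 1) := by
      intro i
      rw [partialD_comm hv i j, partialD_comm (contDiff_partialD hv i) i j]
      rfl
    have h2 := (HasFDerivAt.fun_sum (u := Finset.univ) fun i _ =>
      (((contDiff_partialD (contDiff_partialD hv i) i).differentiable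
        (by simp)) x).hasFDerivAt).fderiv
    have h3 : (fun y => ∑ i, partialD i (partialD i v) y) =ᶠ[nhds x] fun y => -f (v y) := by
      filter_upwards [hΩ.mem_nhds hx] with y hy
      have := hsol y hy
      change ∑ i, partialD i (partialD i v) y + f (v y) = 0 at this
      linarith
    have h4 : HasFDerivAt (fun y => -f (v y)) (-(deriv f (v x) • fderiv ℝ v x)) x :=
      (((hf.differentiable (by simp)) (v x)).hasDerivAt.comp_hasFDerivAt x
        ((hv.differentiable (by simp)) x).hasFDerivAt).fun_neg
    have h5 := h2.symm.trans (h3.fderiv_eq.trans h4.fderiv)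
    have h6 := congrArg (fun L => L (EuclideanSpace.single j (1 : ℝ))) h5
    simp only [sum_apply] at h6
    rw [Finset.sum_congr rfl fun i _ => h1 i, h6]
    simp [partialD]
  simp only [partialD_partialD_sum_sq hv, ← Finset.mul_sum, Finset.sum_add_distrib]
  rw [Finset.sum_comm (f := fun i j => partialD j v x * _)]
  simp only [← Finset.mul_sum, hthird]
  rw [Finset.mul_sum, sub_eq_add_neg, ← Finset.sum_neg_distrib]
  congr 2
  exact Finset.sum_congr rfl fun j _ => by ring

end partialD

section Lipschitz

lemma LipschitzWith.mul_of_bounded {X : Type*} [PseudoMetricSpace X] {a b : X → ℝ}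
    {K L : NNReal} (ha : LipschitzWith K a) (hb : LipschitzWith L b)
    {A B : ℝ} (hA : ∀ x, ‖a x‖ ≤ A) (hB : ∀ x, ‖b x‖ ≤ B) :
    ∃ M : NNReal, LipschitzWith M fun x => a x * b x := by
  refine ⟨_, LipschitzWith.of_dist_le' (K := A * L + K * B) fun x y => ?_⟩
  have h1 := ha.dist_le_mul x y
  have h2 := hb.dist_le_mul x y
  rw [Real.dist_eq] at *
  rw [show a x * b x - a y * b y = a x * (b x - b y) + (a x - a y) * b y by ring]
  refine (abs_add_le _ _).trans ?_
  rw [abs_mul, abs_mul, add_mul, mul_assoc, mul_right_comm]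
  have hA' : |a x| ≤ A := hA x
  have hB' : |b y| ≤ B := hB y
  gcongr
  exact (abs_nonneg _).trans hA'

lemma LipschitzWith.indicator_of_frontier {E : Type*} [NormedAddCommGroup E] [NormedSpace ℝ E]
    {Ω : Set E} (hΩ : IsOpen Ω) {a : E → ℝ} {K : NNReal}
    (ha : LipschitzWith K a) (h0 : ∀ x ∈ frontier Ω, a x = 0) :
    LipschitzWith K (Ω.indicator a) := by
  have key : ∀ x ∈ Ω, ∀ y ∉ Ω, |a x| ≤ K * dist x y := by
    intro x hx y hy
    obtain ⟨z, hz, hzf⟩ : ∃ z ∈ segment ℝ x y, z ∈ frontier Ω := by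
      by_contra! hcon
      have hsub : segment ℝ x y ⊆ Ω ∪ (closure Ω)ᶜ := by
        intro z hz
        by_cases hzΩ : z ∈ Ω
        · exact Or.inl hzΩ
        · refine Or.inr fun hzc => hcon z hz ?_
          rw [hΩ.frontier_eq]
          exact ⟨hzc, hzΩ⟩
      rcases (convex_segment x y).isPreconnected.subset_or_subset hΩ
        isClosed_closure.isOpen_compl
        (Set.disjoint_left.2 fun z hz hz' => hz' (subset_closure hz)) hsub with h | h
      · exact hy (h (right_mem_segment ℝ x y))
      · exact h (left_mem_segment ℝ x y) (subset_closure hx)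
    have h1 := ha.dist_le_mul x z
    rw [h0 z hzf, Real.dist_eq, sub_zero] at h1
    refine h1.trans ?_
    gcongr
    have := dist_add_dist_of_mem_segment hz
    linarith [dist_nonneg (x := z) (y := y)]
  refine LipschitzWith.of_dist_le_mul fun x y => ?_
  by_cases hx : x ∈ Ω <;> by_cases hy : y ∈ Ω
  · simpa [hx, hy] using ha.dist_le_mul x y
  · simpa [hx, hy, Real.dist_eq] using key x hx y hy
  · simpa [hx, hy, Real.dist_eq, dist_comm] using key y hy x hx
  · simp only [Set.indicator_of_notMem hx, Set.indicator_of_notMem hy, dist_self]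
    positivity

end Lipschitz

section Integration

variable {n : ℕ} {Ω : Set (EuclideanSpace ℝ (Fin n))}

lemma Continuous.memLp_top_restrict {h : EuclideanSpace ℝ (Fin n) → ℝ} (hh : Continuous h)
    (hΩ : IsOpen Ω) (hb : Bornology.IsBounded Ω) :
    MemLp h ⊤ (volume.restrict Ω) := by
  obtain ⟨C, hC⟩ := (hb.isCompact_closure).exists_bound_of_continuousOn hh.continuousOn
  refine memLp_top_of_bound hh.aestronglyMeasurable C ?_
  filter_upwards [ae_restrict_mem hΩ.measurableSet] with x hx using hC x (subset_closure hx)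

lemma MeasureTheory.MemLp.mul_top {α : Type*} [MeasurableSpace α] {μ : Measure α} {a b : α → ℝ}
    (ha : MemLp a ⊤ μ) (hb : MemLp b ⊤ μ) : MemLp (fun x => a x * b x) ⊤ μ :=
  hb.mul ha

lemma LipschitzWith.memLp_top_partialD {g : EuclideanSpace ℝ (Fin n) → ℝ} {K : NNReal}
    (hg : LipschitzWith K g) (i : Fin n) (μ : Measure (EuclideanSpace ℝ (Fin n))) :
    MemLp (partialD i g) ⊤ μ := by
  refine memLp_top_of_bound (measurable_fderiv_apply_const ℝ g _).aestronglyMeasurable K ?_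
  refine ae_of_all _ fun x => ?_
  have h1 := (fderiv ℝ g x).le_opNorm (EuclideanSpace.single i (1 : ℝ))
  have h2 := norm_fderiv_le_of_lipschitz ℝ hg (x₀ := x)
  simp only [PiLp.norm_single, norm_one, mul_one] at h1
  exact h1.trans h2

/-- Integration by parts against the square of a Lipschitz function supported in `Ω`. -/
lemma setIntegral_partialD_sq_mul {g h : EuclideanSpace ℝ (Fin n) → ℝ}
    {K : NNReal} (hΩ : IsOpen Ω) (hb : Bornology.IsBounded Ω) (hg : LipschitzWith K g)
    (hg0 : ∀ x ∉ Ω, g x = 0)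
    (hh : ContDiff ℝ (⊤ : ℕ∞) h) (hhc : HasCompactSupport h) (i : Fin n) :
    ∫ x in Ω, (2 * (g x * partialD i g x * h x) + g x ^ 2 * partialD i h x) = 0 := by
  have hgc : HasCompactSupport g :=
    HasCompactSupport.intro hb.isCompact_closure fun x hx => hg0 x fun h => hx (subset_closure h)
  obtain ⟨B, hB⟩ := hg.continuous.bounded_above_of_compact_support hgc
  obtain ⟨M, hM⟩ := hg.mul_of_bounded hg hB hB
  obtain ⟨L, hL⟩ := hh.lipschitzWith_of_hasCompactSupport hhc (by simp)
  have hae := hg.ae_differentiableAt (μ := volume)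
  have hibp := LipschitzWith.integral_lineDeriv_mul_eq (μ := volume) hL hM hgc.mul_right
    (EuclideanSpace.single i (1 : ℝ))
  have e1 : ∀ x, lineDeriv ℝ h x (EuclideanSpace.single i (1 : ℝ)) = partialD i h x := fun x =>
    (hh.differentiable (by simp) x).lineDeriv_eq_fderiv
  have e2 : ∀ᵐ x, lineDeriv ℝ (fun x => g x * g x) x (-EuclideanSpace.single i (1 : ℝ)) * h x =
      -(2 * (g x * partialD i g x * h x)) := by
    filter_upwards [hae] with x hx
    rw [lineDeriv_neg, (hx.fun_mul hx).lineDeriv_eq_fderiv, fderiv_fun_mul hx hx]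
    simp only [add_apply, smul_apply, smul_eq_mul,
      partialD]
    ring
  rw [integral_congr_ae e2] at hibp
  simp only [e1] at hibp
  rw [← setIntegral_eq_integral_of_forall_compl_eq_zero (s := Ω) (μ := volume)
      (f := fun x => partialD i h x * (g x * g x)) (fun x hx => by simp [hg0 x hx]),
    ← setIntegral_eq_integral_of_forall_compl_eq_zero (s := Ω) (μ := volume) (fun x hx => by
      simp [hg0 x hx]), integral_neg] at hibp
  have : IsFiniteMeasure (volume.restrict Ω) := ⟨by simpa using hb.measure_lt_top⟩
  have mg := hg.continuous.memLp_top_restrict hΩ hb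
  have mh := hh.continuous.memLp_top_restrict hΩ hb
  have mh' := (contDiff_partialD hh i).continuous.memLp_top_restrict hΩ hb
  have mg' := hg.memLp_top_partialD i (volume.restrict Ω)
  rw [integral_add]
  · have : ∀ x, g x ^ 2 * partialD i h x = partialD i h x * (g x * g x) := fun x => by ring
    simp only [this]
    linarith
  · exact (((mg.mul_top mg').mul_top mh).integrable le_top).const_mul 2
  · simp only [sq]
    exact ((mg.mul_top mg).mul_top mh').integrable le_top

end Integration

section Regularized

variable {n : ℕ} {v g : EuclideanSpace ℝ (Fin n) → ℝ} {ε : ℝ}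

lemma contDiff_sum_sq_partialD (hv : ContDiff ℝ (⊤ : ℕ∞) v) :
    ContDiff ℝ (⊤ : ℕ∞) fun x => ∑ j, partialD j v x ^ 2 :=
  ContDiff.sum fun j _ => (contDiff_partialD hv j).pow 2

lemma hasCompactSupport_sum_sq_partialD (hvc : HasCompactSupport v) :
    HasCompactSupport fun x => ∑ j, partialD j v x ^ 2 := by
  refine HasCompactSupport.intro hvc fun x hx => Finset.sum_eq_zero fun j _ => ?_
  have h : x ∉ tsupport (partialD j v) := fun h =>
    hx (tsupport_fderiv_apply_subset ℝ (EuclideanSpace.single j (1 : ℝ)) h)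
  rw [image_eq_zero_of_notMem_tsupport h]
  simp

/-- The regularized gradient norm times a compactly supported Lipschitz function is Lipschitz. -/
lemma exists_lipschitzWith_sqrt_mul {K : NNReal} (hv : ContDiff ℝ (⊤ : ℕ∞) v)
    (hvc : HasCompactSupport v) (hg : LipschitzWith K g) (hgc : HasCompactSupport g)
    (hε : 0 < ε) :
    ∃ M : NNReal, LipschitzWith M
      fun x => Real.sqrt (∑ j, partialD j v x ^ 2 + ε ^ 2) * g x := by
  set c : EuclideanSpace ℝ (Fin n) → ℝ :=
    fun x => Real.sqrt (∑ j, partialD j v x ^ 2 + ε ^ 2) - ε with hc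
  have hcd : ContDiff ℝ (⊤ : ℕ∞) c := by
    refine ContDiff.sub (ContDiff.sqrt ((contDiff_sum_sq_partialD hv).add contDiff_const)
      fun x => ?_) contDiff_const
    positivity
  have hcc : HasCompactSupport c :=
    (hasCompactSupport_sum_sq_partialD hvc).comp_left
      (g := fun t => Real.sqrt (t + ε ^ 2) - ε) (by simp [Real.sqrt_sq hε.le])
  obtain ⟨L, hL⟩ := hcd.lipschitzWith_of_hasCompactSupport hcc (by simp)
  obtain ⟨A, hA⟩ := hcd.continuous.bounded_above_of_compact_support hcc
  obtain ⟨B, hB⟩ := hg.continuous.bounded_above_of_compact_support hgc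
  obtain ⟨M, hM⟩ := hL.mul_of_bounded hg hA hB
  obtain ⟨M', hM'⟩ := (LipschitzWith.const (α := EuclideanSpace ℝ (Fin n)) ε).mul_of_bounded hg
    (fun _ => le_rfl) hB
  refine ⟨M + M', ?_⟩
  have h : (fun x => Real.sqrt (∑ j, partialD j v x ^ 2 + ε ^ 2) * g x) =
      fun x => c x * g x + ε * g x := by
    funext x
    simp only [hc]
    ring
  rw [h]
  exact hM.add hM'

lemma partialD_sqrt_mul (hv : ContDiff ℝ (⊤ : ℕ∞) v) (hε : 0 < ε)
    {x : EuclideanSpace ℝ (Fin n)} (hg : DifferentiableAt ℝ g x) (i : Fin n) :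
    partialD i (fun x => Real.sqrt (∑ j, partialD j v x ^ 2 + ε ^ 2) * g x) x ^ 2 =
      (∑ j, partialD j v x ^ 2 + ε ^ 2) * partialD i g x ^ 2 +
      g x * partialD i g x * partialD i (fun x => ∑ j, partialD j v x ^ 2) x +
      g x ^ 2 * (partialD i (fun x => ∑ j, partialD j v x ^ 2) x ^ 2 /
        (4 * (∑ j, partialD j v x ^ 2 + ε ^ 2))) := by
  have hw : 0 < ∑ j, partialD j v x ^ 2 + ε ^ 2 := by positivity
  have hq := (((contDiff_sum_sq_partialD hv).differentiable (by simp)) x).hasFDerivAt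
  have h := (((hq.add_const (ε ^ 2)).sqrt hw.ne').fun_mul hg.hasFDerivAt).fderiv
  rw [partialD, h]
  set q := fun x => ∑ j, partialD j v x ^ 2 with hqdef
  simp only [add_apply, smul_apply, smul_eq_mul]
  change (_ * partialD i g x + g x * (_ * partialD i q x)) ^ 2 = _
  have hs := Real.sq_sqrt hw.le
  have hs0 := (Real.sqrt_pos.2 hw).ne'
  change 0 < q x + ε ^ 2 at hw
  change Real.sqrt (q x + ε ^ 2) ^ 2 = q x + ε ^ 2 at hs
  change Real.sqrt (q x + ε ^ 2) ≠ 0 at hs0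
  change _ = (q x + ε ^ 2) * _ + _ + g x ^ 2 * (_ / (4 * (q x + ε ^ 2)))
  change (Real.sqrt (q x + ε ^ 2) * _ + g x * (1 / (2 * Real.sqrt (q x + ε ^ 2)) * _)) ^ 2 = _
  generalize Real.sqrt (q x + ε ^ 2) = s at hs hs0
  rw [← hs]
  field_simp
  ring

/-- The regularized stability inequality for compactly supported smooth `v` and a Lipschitz test
function vanishing outside `Ω`. -/
lemma regularized_stability_of_hasCompactSupport {Ω : Set (EuclideanSpace ℝ (Fin n))}
    (hΩ : IsOpen Ω) (hb : Bornology.IsBounded Ω) {f : ℝ → ℝ} (hf : ContDiff ℝ (⊤ : ℕ∞) f)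
    (hv : ContDiff ℝ (⊤ : ℕ∞) v) (hvc : HasCompactSupport v)
    (hsol : ∀ x ∈ Ω, lapl v x + f (v x) = 0) (hstab : IsSemiStable Ω f v)
    {K : NNReal} (hg : LipschitzWith K g) (hg0 : ∀ x ∉ Ω, g x = 0) (hε : 0 < ε) :
    (∫ x in Ω, deriv f (v x) * ε ^ 2 * g x ^ 2) +
      (∫ x in Ω, ((∑ i, ∑ j, hess v x i j ^ 2) -
        (∑ i, (∑ j, hess v x i j * gradient v x j) ^ 2) /
          (‖gradient v x‖ ^ 2 + ε ^ 2)) * g x ^ 2)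
    ≤ ∫ x in Ω, (‖gradient v x‖ ^ 2 + ε ^ 2) * ‖gradient g x‖ ^ 2 := by
  have hgc : HasCompactSupport g :=
    HasCompactSupport.intro hb.isCompact_closure fun x hx => hg0 x fun h => hx (subset_closure h)
  have h0 := hstab _ (exists_lipschitzWith_sqrt_mul hv hvc hg hgc hε) (fun x hx => by
    have : x ∉ Ω := by
      rw [hΩ.frontier_eq] at hx
      exact hx.2
    simp [hg0 x this])
  have hhess : ∀ x i j, hess v x i j = partialD i (partialD j v) x := fun _ _ _ => rfl
  simp only [hhess, norm_gradient_sq_eq_sum, gradient_apply_eq_partialD] at h0 ⊢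
  set q : EuclideanSpace ℝ (Fin n) → ℝ := fun x => ∑ j, partialD j v x ^ 2 with hq
  have hqd : ContDiff ℝ (⊤ : ℕ∞) q := contDiff_sum_sq_partialD hv
  have hqc : HasCompactSupport q := hasCompactSupport_sum_sq_partialD hvc
  have hqpos : ∀ x, 0 < q x + ε ^ 2 := fun x => by
    have : 0 ≤ q x := Finset.sum_nonneg fun j _ => sq_nonneg _
    positivity
  have hpq := partialD_sum_sq hv
  let A x := (q x + ε ^ 2) * ∑ i, partialD i g x ^ 2
  let D i x := 2 * (g x * partialD i g x * partialD i q x) + g x ^ 2 * partialD i (partialD i q) x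
  let B x := deriv f (v x) * ε ^ 2 * g x ^ 2
  let C x := (∑ i, ∑ j, partialD i (partialD j v) x ^ 2 -
    (∑ i, (∑ j, partialD i (partialD j v) x * partialD j v x) ^ 2) / (q x + ε ^ 2)) * g x ^ 2
  have hfin : IsFiniteMeasure (volume.restrict Ω) := ⟨by simpa using hb.measure_lt_top⟩
  have hpt : ∀ᵐ x ∂volume.restrict Ω,
      ∑ i, partialD i (fun x => Real.sqrt (q x + ε ^ 2) * g x) x ^ 2 -
        deriv f (v x) * (Real.sqrt (q x + ε ^ 2) * g x) ^ 2 =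
      (A x + (1 / 2) * ∑ i, D i x) - (B x + C x) := by
    filter_upwards [ae_restrict_mem hΩ.measurableSet,
      ae_restrict_of_ae (hg.ae_differentiableAt (μ := volume))] with x hx hgx
    have hw := hqpos x
    have hB := sum_partialD_partialD_norm_sq hΩ hf hv hsol hx
    rw [Finset.sum_congr rfl fun i _ => partialD_sqrt_mul hv hε hgx i]
    have hsum : ∑ i, D i x = 2 * ∑ i, g x * partialD i g x * partialD i q x +
        g x ^ 2 * ∑ i, partialD i (partialD i q) x := by
      simp only [D, Finset.sum_add_distrib, Finset.mul_sum]
    have hQ : ∑ i, g x ^ 2 * (partialD i q x ^ 2 / (4 * (q x + ε ^ 2))) =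
        (∑ i, (∑ j, partialD i (partialD j v) x * partialD j v x) ^ 2) / (q x + ε ^ 2) *
          g x ^ 2 := by
      rw [Finset.sum_div, Finset.sum_mul]
      refine Finset.sum_congr rfl fun i _ => ?_
      rw [congrFun (hpq i) x]
      field_simp
      ring
    change ∑ i, ((q x + ε ^ 2) * partialD i g x ^ 2 + g x * partialD i g x * partialD i q x +
      g x ^ 2 * (partialD i q x ^ 2 / (4 * (q x + ε ^ 2)))) - _ = _
    change ∑ i, partialD i (partialD i q) x = 2 * (_ - _ * q x) at hB
    rw [Finset.sum_add_distrib, Finset.sum_add_distrib, ← Finset.mul_sum, hQ, hsum, hB, mul_pow,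
      Real.sq_sqrt hw.le]
    simp only [A, B, C]
    ring
  have mg := hg.continuous.memLp_top_restrict hΩ hb
  have mpg := fun i => hg.memLp_top_partialD i (volume.restrict Ω)
  have hdv : ∀ i, Continuous (partialD i v) := fun i => (contDiff_partialD hv i).continuous
  have hddv : ∀ i j, Continuous (partialD i (partialD j v)) := fun i j =>
    (contDiff_partialD (contDiff_partialD hv j) i).continuous
  have hdf : Continuous (deriv f) := hf.continuous_deriv (by simp)
  have mg2 : MemLp (fun x => g x ^ 2) ⊤ (volume.restrict Ω) := by
    simpa only [sq] using mg.mul_top mg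
  have iA : Integrable A (volume.restrict Ω) := by
    have m1 : MemLp (fun x => ∑ i, partialD i g x ^ 2) ⊤ (volume.restrict Ω) :=
      memLp_finsetSum _ fun i _ => by simpa only [sq] using (mpg i).mul_top (mpg i)
    exact ((((hqd.continuous.add continuous_const).memLp_top_restrict hΩ hb).mul_top
      m1).integrable le_top)
  have iD : ∀ i, Integrable (D i) (volume.restrict Ω) := fun i =>
    ((((mg.mul_top (mpg i)).mul_top ((contDiff_partialD hqd i).continuous.memLp_top_restrict
      hΩ hb)).integrable le_top).const_mul 2).add ((mg2.mul_top
      ((contDiff_partialD (contDiff_partialD hqd i) i).continuous.memLp_top_restrict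
        hΩ hb)).integrable le_top)
  have iB : Integrable B (volume.restrict Ω) :=
    ((((hdf.comp hv.continuous).mul continuous_const).memLp_top_restrict hΩ hb).mul_top
      mg2).integrable le_top
  have iC : Integrable C (volume.restrict Ω) := by
    refine (MemLp.mul_top (Continuous.memLp_top_restrict ?_ hΩ hb) mg2).integrable le_top
    refine Continuous.sub (by fun_prop) (Continuous.div (by fun_prop) ?_ fun x => (hqpos x).ne')
    exact hqd.continuous.add continuous_const
  have hD : ∫ x in Ω, ∑ i, D i x = 0 := by
    rw [integral_finsetSum _ fun i _ => iD i]
    exact Finset.sum_eq_zero fun i _ => setIntegral_partialD_sq_mul hΩ hb hg hg0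
      (contDiff_partialD hqd i) (hasCompactSupport_partialD hqc i) i
  have iD' : Integrable (fun x => (1 / 2) * ∑ i, D i x) (volume.restrict Ω) :=
    (integrable_finsetSum _ fun i _ => iD i).const_mul _
  have h1 := integral_congr_ae hpt
  have h3 := integral_sub (iA.add iD') (iB.add iC)
  simp only [Pi.add_apply] at h3
  rw [h3, integral_add iA iD', integral_add iB iC,
    integral_const_mul, hD] at h1
  have h2 : 0 ≤ ∫ x in Ω, (∑ i, partialD i (fun x => Real.sqrt (q x + ε ^ 2) * g x) x ^ 2 -
        deriv f (v x) * (Real.sqrt (q x + ε ^ 2) * g x) ^ 2) := h0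
  change (∫ x in Ω, B x) + (∫ x in Ω, C x) ≤ ∫ x in Ω, A x
  linarith

end Regularized

/-- A smooth function near a compact set agrees near it with a compactly supported smooth
function on the whole space. -/
lemma exists_contDiff_hasCompactSupport_eventuallyEq {n : ℕ} {S U : Set (EuclideanSpace ℝ (Fin n))}
    {u : EuclideanSpace ℝ (Fin n) → ℝ} (hS : IsCompact S) (hU : IsOpen U) (hSU : S ⊆ U)
    (hu : ContDiffOn ℝ (⊤ : ℕ∞) u U) :
    ∃ v : EuclideanSpace ℝ (Fin n) → ℝ, ContDiff ℝ (⊤ : ℕ∞) v ∧ HasCompactSupport v ∧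
      ∀ x ∈ S, v =ᶠ[nhds x] u := by
  obtain ⟨L, hL, hSL, hLU⟩ := exists_compact_between hS hU hSU
  obtain ⟨χ, hχ1, hχ0, -⟩ := exists_contMDiffMap_one_nhds_of_subset_interior
    (n := (⊤ : ℕ∞)) (modelWithCornersSelf ℝ (EuclideanSpace ℝ (Fin n))) hS.isClosed hSL
  have hχd : ContDiff ℝ (⊤ : ℕ∞) χ := χ.contMDiff.contDiff
  refine ⟨fun x => χ x * u x, ?_, ?_, ?_⟩
  · rw [contDiff_iff_contDiffAt]
    intro x
    by_cases hx : x ∈ L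
    · exact hχd.contDiffAt.mul (hu.contDiffAt (hU.mem_nhds (hLU hx)))
    · refine contDiffAt_const (c := (0 : ℝ)) |>.congr_of_eventuallyEq ?_
      filter_upwards [hL.isClosed.isOpen_compl.mem_nhds hx] with y hy
      simp [hχ0 y hy]
  · exact HasCompactSupport.intro hL fun x hx => by simp [hχ0 x hx]
  · intro x hx
    filter_upwards [hχ1.filter_mono (nhds_le_nhdsSet hx)] with y hy
    simp [hy]

/-- (Regularized stability inequality.) -/
theorem regularized_stability_inequality
    (n : ℕ) (hn : 1 ≤ n)
    (Ω : Set (EuclideanSpace ℝ (Fin n))) (hΩ : IsSmoothBoundedDomain Ω)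
    (f : ℝ → ℝ) (hf : ContDiff ℝ (⊤ : ℕ∞) f)
    (u : EuclideanSpace ℝ (Fin n) → ℝ)
    (husmooth : ∃ U, IsOpen U ∧ closure Ω ⊆ U ∧ ContDiffOn ℝ (⊤ : ℕ∞) u U)
    (hsol : IsClassicalSol Ω f u) (hstab : IsSemiStable Ω f u)
    (η : EuclideanSpace ℝ (Fin n) → ℝ)
    (hη : ∃ K : NNReal, LipschitzWith K η)
    (hη0 : ∀ x ∈ frontier Ω, η x = 0)
    (ε : ℝ) (hε : 0 < ε) :
    (∫ x in Ω, deriv f (u x) * ε ^ 2 * η x ^ 2) +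
      (∫ x in Ω, ((∑ i, ∑ j, hess u x i j ^ 2) -
        (∑ i, (∑ j, hess u x i j * gradient u x j) ^ 2) /
          (‖gradient u x‖ ^ 2 + ε ^ 2)) * η x ^ 2)
    ≤ ∫ x in Ω, (‖gradient u x‖ ^ 2 + ε ^ 2) * ‖gradient η x‖ ^ 2 := by
  obtain ⟨hΩo, hb, -, -⟩ := hΩ
  obtain ⟨U, hU, hΩU, hu⟩ := husmooth
  obtain ⟨K, hK⟩ := hη
  obtain ⟨v, hv, hvc, hvu⟩ :=
    exists_contDiff_hasCompactSupport_eventuallyEq hb.isCompact_closure hU hΩU hu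
  have hev : ∀ x ∈ Ω, v =ᶠ[nhds x] u := fun x hx => hvu x (subset_closure hx)
  have hval : ∀ x ∈ Ω, v x = u x := fun x hx => (hev x hx).eq_of_nhds
  have hgrad : ∀ x ∈ Ω, gradient v x = gradient u x := fun x hx => (hev x hx).gradient.eq_of_nhds
  have hhess : ∀ x ∈ Ω, ∀ i j, hess v x i j = hess u x i j := by
    intro x hx i j
    have h : (fun y => fderiv ℝ v y (EuclideanSpace.single j 1)) =ᶠ[nhds x]
        fun y => fderiv ℝ u y (EuclideanSpace.single j 1) := by
      filter_upwards [(hev x hx).fderiv (𝕜 := ℝ)] with y hy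
      rw [hy]
    rw [hess, h.fderiv_eq, hess]
  have hlapl : ∀ x ∈ Ω, lapl v x + f (v x) = 0 := by
    intro x hx
    rw [hval x hx, ← hsol.2.1 x hx]
    exact congrArg (· + f (u x)) (Finset.sum_congr rfl fun i _ => hhess x hx i i)
  have hstab' : IsSemiStable Ω f v := by
    intro ξ hξ hξ0
    refine (hstab ξ hξ hξ0).trans_eq (setIntegral_congr_fun hΩo.measurableSet fun x hx => ?_)
    simp only [hval x hx]
  have key := regularized_stability_of_hasCompactSupport hΩo hb hf hv hvc hlapl hstab'
    (hK.indicator_of_frontier hΩo hη0) (fun x hx => Set.indicator_of_notMem hx η) hε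
  have hind : ∀ x ∈ Ω, Ω.indicator η x = η x := fun x hx => Set.indicator_of_mem hx η
  have hindgrad : ∀ x ∈ Ω, gradient (Ω.indicator η) x = gradient η x := by
    intro x hx
    have h : Ω.indicator η =ᶠ[nhds x] η := by
      filter_upwards [hΩo.mem_nhds hx] with y hy using hind y hy
    exact h.gradient.eq_of_nhds
  convert key using 1
  · congr 1
    · exact setIntegral_congr_fun hΩo.measurableSet fun x hx => by
        simp only [hval x hx, hind x hx]
    · exact setIntegral_congr_fun hΩo.measurableSet fun x hx => by
        simp only [hhess x hx, hgrad x hx, hind x hx]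
  · exact setIntegral_congr_fun hΩo.measurableSet fun x hx => by
      simp only [hgrad x hx, hindgrad x hx]
end
end
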